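/- arXiv:2307.12415 — 2 statements merged into one kernel-verified Lean document; each statement's English description precedes it below -/
import Mathlib

section
/- Every element of U'(𝔤) can be written uniquely as a sum Σ_{a ∈ {0,…,p−1}^n} e^a·v_a with each v_a in the image of U'(𝔥) → U'(𝔤), and also uniquely as a sum Σ_{a ∈ {0,…,p−1}^n} w_a·e^a with each w_a in that image; in particular U'(𝔤) is a free left and a free right U'(𝔥)-module of rank p^n with basis {e^a : a ∈ {0,…,p−1}^n}. -/
noncomputable section

/-- The relation on `U(𝔤)` whose closure defines the restricted enveloping algebra:
`ι(x)^p ∼ ι(x^[p])`.  The quotient `RingQuot` of this relation is the quotient of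
`U(𝔤)` by the two-sided ideal generated by the elements `ι(x)^p − ι(x^[p])`. -/
def rRel (k : Type*) [Field k] (L : Type*) [LieRing L] [LieAlgebra k L]
    (p : ℕ) (pOp : L → L) :
    UniversalEnvelopingAlgebra k L → UniversalEnvelopingAlgebra k L → Prop :=
  fun x y => ∃ X : L,
    x = UniversalEnvelopingAlgebra.ι k X ^ p ∧ y = UniversalEnvelopingAlgebra.ι k (pOp X)

/-- The restricted enveloping algebra `U'(𝔤) = U(𝔤)/I`. -/
abbrev RUEA (k : Type*) [Field k] (L : Type*) [LieRing L] [LieAlgebra k L]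
    (p : ℕ) (pOp : L → L) : Type _ :=
  RingQuot (rRel k L p pOp)

/-- `ι' : 𝔤 → U'(𝔤)`, the composite of `ι` with the quotient map. -/
def rι (k : Type*) [Field k] {L : Type*} [LieRing L] [LieAlgebra k L]
    (p : ℕ) (pOp : L → L) (X : L) : RUEA k L p pOp :=
  RingQuot.mkAlgHom k (rRel k L p pOp) (UniversalEnvelopingAlgebra.ι k X)

/-- For `a ∈ {0,…,p−1}^n`, the ordered monomial `e^a = ι'(e_1)^{a_1} ⋯ ι'(e_n)^{a_n}`
in `U'(𝔤)`. -/
def eMonR (k : Type*) [Field k] {L : Type*} [LieRing L] [LieAlgebra k L]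
    (p : ℕ) (pOp : L → L) {n : ℕ} (e : Fin n → L) (a : Fin n → Fin p) :
    RUEA k L p pOp :=
  ((List.finRange n).map fun i => rι k p pOp (e i) ^ (a i : ℕ)).prod

section Rewriting

variable {k V W : Type*} [CommRing k] [AddCommGroup V] [Module k V]

/-- The span of the differences `b u - g`, for the one-step rewritings of `b u` into `g` with
`u` strictly below `w`. -/
def rewriteBelow (b : Module.Basis W k V) (r : W → W → Prop) (Rew : W → V → Prop) (w : W) :
    Submodule k V :=
  Submodule.span k {x | ∃ u g, Rew u g ∧ r u w ∧ x = b u - g}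

open scoped Classical in
/-- The normal form of a basis vector under a terminating rewriting. -/
def normalFormAux (b : Module.Basis W k V) {r : W → W → Prop} (hr : WellFounded r)
    (Rew : W → V → Prop) : W → V :=
  hr.fix fun w N =>
    if h : ∃ g, Rew w g then
      (b.repr h.choose).sum fun u c => if hu : r u w then c • N u hu else 0
    else b w

variable (b : Module.Basis W k V) {r : W → W → Prop} (hr : WellFounded r) (Rew : W → V → Prop)

/-- The linear extension of `normalFormAux`. -/
def normalForm : V →ₗ[k] V := b.constr k (normalFormAux b hr Rew)

lemma normalForm_of_irreducible {w : W} (h : ∀ g, ¬ Rew w g) :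
    normalForm b hr Rew (b w) = b w := by
  rw [normalForm, Module.Basis.constr_basis, normalFormAux, WellFounded.fix_eq, dif_neg]
  rintro ⟨g, hg⟩
  exact h g hg

lemma exists_rewrite_normalForm_eq
    (hsmall : ∀ w g, Rew w g → g ∈ Submodule.span k (b '' {u | r u w}))
    {w : W} (h : ∃ g, Rew w g) :
    ∃ g, Rew w g ∧ normalForm b hr Rew (b w) = normalForm b hr Rew g := by
  refine ⟨h.choose, h.choose_spec, ?_⟩
  have hs := (Module.Basis.mem_span_image b).1 (hsmall w _ h.choose_spec)
  conv_lhs => rw [normalForm, Module.Basis.constr_basis, normalFormAux, WellFounded.fix_eq]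
  rw [dif_pos h, normalForm, Module.Basis.constr_apply]
  refine Finsupp.sum_congr fun u hu => ?_
  have huw : r u w := hs hu
  rw [dif_pos huw]
  rfl

/-- Newman's diamond lemma for linear rewriting: if any two rewritings of a basis vector agree
modulo rewritings of strictly smaller ones, then the normal form is a rewriting invariant. -/
theorem normalForm_eq_of_rewrite
    (hsmall : ∀ w g, Rew w g → g ∈ Submodule.span k (b '' {u | r u w}))
    (hconf : ∀ w g g', Rew w g → Rew w g' → g - g' ∈ rewriteBelow b r Rew w)
    (w : W) (g : V) (h : Rew w g) :
    normalForm b hr Rew (b w) = normalForm b hr Rew g := by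
  induction w using hr.induction generalizing g with
  | _ w ih =>
    obtain ⟨g', hg', e⟩ := exists_rewrite_normalForm_eq b hr Rew hsmall ⟨g, h⟩
    have hle : rewriteBelow b r Rew w ≤ LinearMap.ker (normalForm b hr Rew) := by
      refine Submodule.span_le.2 ?_
      rintro _ ⟨u, g, hu, huw, rfl⟩
      simp [ih u huw g hu]
    have := hle (hconf w g' g hg' h)
    rw [LinearMap.mem_ker, map_sub, sub_eq_zero] at this
    rw [e, this]

include hr in
/-- Modulo the rewritings, the space is spanned by the irreducible basis vectors. -/
theorem eq_top_of_rewrite_of_irreducible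
    (hsmall : ∀ w g, Rew w g → g ∈ Submodule.span k (b '' {u | r u w}))
    (S : Submodule k V) (hS : ∀ w g, Rew w g → b w - g ∈ S)
    (hirr : ∀ w, (∀ g, ¬ Rew w g) → b w ∈ S) : S = ⊤ := by
  rw [eq_top_iff, ← b.span_eq, Submodule.span_le]
  rintro _ ⟨w, rfl⟩
  induction w using hr.induction with
  | _ w ih =>
    by_cases h : ∃ g, Rew w g
    · obtain ⟨g, hg⟩ := h
      have : g ∈ S := by
        refine Submodule.span_le.2 ?_ (hsmall w g hg)
        rintro _ ⟨u, hu, rfl⟩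
        exact ih u hu
      simpa using S.add_mem (hS w g hg) this
    · exact hirr w (not_exists.1 h)

end Rewriting

section FreeAlgebraWords

variable (k : Type*) {X : Type*} [CommRing k]

/-- The monomial of the free algebra attached to a word. -/
def wordMon (w : List X) : FreeAlgebra k X := (w.map (FreeAlgebra.ι k)).prod

@[simp] lemma wordMon_nil : wordMon k ([] : List X) = 1 := rfl

@[simp] lemma wordMon_cons (x : X) (w : List X) :
    wordMon k (x :: w) = FreeAlgebra.ι k x * wordMon k w := by simp [wordMon]

@[simp] lemma wordMon_append (u w : List X) :
    wordMon k (u ++ w) = wordMon k u * wordMon k w := by simp [wordMon]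

@[simp] lemma wordMon_replicate (m : ℕ) (x : X) :
    wordMon k (List.replicate m x) = FreeAlgebra.ι k x ^ m := by simp [wordMon]

variable (X) in
/-- The basis of the free algebra given by the words. -/
def wordBasis : Module.Basis (List X) k (FreeAlgebra k X) :=
  (FreeAlgebra.basisFreeMonoid k X).reindex FreeMonoid.toList

@[simp] lemma wordBasis_apply (w : List X) : wordBasis k X w = wordMon k w := by
  rw [wordBasis, Module.Basis.reindex_apply, FreeAlgebra.basisFreeMonoid]
  simp [FreeAlgebra.equivMonoidAlgebraFreeMonoid, wordMon, FreeMonoid.lift_apply]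

end FreeAlgebraWords

section Shortlex

variable {X : Type*} {r : X → X → Prop}

lemma List.Lex.append_right_of_length_eq :
    ∀ {u v : List X}, u.length = v.length → List.Lex r u v → ∀ t, List.Lex r (u ++ t) (v ++ t)
  | _, _, h, .nil, _ => by simp at h
  | _, _, _, .rel h', _ => .rel h'
  | _, _, h, .cons h', t => .cons (List.Lex.append_right_of_length_eq (by simpa using h) h' t)

lemma List.Shortlex.append_append {u v : List X} (h : List.Shortlex r u v) (s t : List X) :
    List.Shortlex r (s ++ u ++ t) (s ++ v ++ t) := by
  rw [List.append_assoc, List.append_assoc]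
  refine List.Shortlex.append_left ?_ s
  rcases List.shortlex_def.1 h with h | ⟨h, h'⟩
  · exact .of_length_lt (by simpa using h)
  · exact .of_lex (by simpa using h) (h'.append_right_of_length_eq h t)

end Shortlex

section RestrictedRules

variable {k L X : Type*} [Field k] [LieRing L] [LieAlgebra k L] [LinearOrder X]
  (x : Module.Basis X k L) (p : ℕ) (pOp : L → L)

/-- The linear embedding of `L` in the free algebra on a basis of `L`. -/
def basisLin : L →ₗ[k] FreeAlgebra k X := x.constr k (FreeAlgebra.ι k)

omit [LinearOrder X] in
@[simp] lemma basisLin_basis (i : X) : basisLin x (x i) = FreeAlgebra.ι k i := by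
  simp [basisLin]

/-- The reduction rules of the restricted enveloping algebra: sorting two adjacent letters, and
replacing a `p`-th power by the `p`-operation. -/
inductive RRule : List X → FreeAlgebra k X → Prop
  | comm (i j : X) (h : i < j) :
      RRule [j, i] (FreeAlgebra.ι k i * FreeAlgebra.ι k j + basisLin x ⁅x j, x i⁆)
  | pow (i : X) : RRule (List.replicate p i) (basisLin x (pOp (x i)))

/-- One-step rewriting of words by the reduction rules. -/
def RRew (w : List X) (g : FreeAlgebra k X) : Prop :=
  ∃ a s c f, RRule x p pOp s f ∧ w = a ++ s ++ c ∧ g = wordMon k a * f * wordMon k c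

/-- The span of the rewritings of words of length at most `d`. -/
def rewriteLE (d : ℕ) : Submodule k (FreeAlgebra k X) :=
  Submodule.span k {y | ∃ u g, RRew x p pOp u g ∧ u.length ≤ d ∧ y = wordMon k u - g}

/-- The span of the rewritings of words below `w` in the shortlex order. -/
def rewriteLT (w : List X) : Submodule k (FreeAlgebra k X) :=
  rewriteBelow (wordBasis k X) (List.Shortlex (· < ·)) (RRew x p pOp) w

variable {x p pOp}

lemma RRule.rew {s : List X} {f : FreeAlgebra k X} (h : RRule x p pOp s f) (a c : List X) :
    RRew x p pOp (a ++ s ++ c) (wordMon k a * f * wordMon k c) :=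
  ⟨a, s, c, f, h, rfl, rfl⟩

lemma RRew.append_append {w : List X} {g : FreeAlgebra k X} (h : RRew x p pOp w g)
    (a c : List X) :
    RRew x p pOp (a ++ w ++ c) (wordMon k a * g * wordMon k c) := by
  obtain ⟨a', s, c', f, hs, rfl, rfl⟩ := h
  exact ⟨a ++ a', s, c' ++ c, f, hs, by simp, by simp [mul_assoc]⟩

lemma RRew.sub_mem_rewriteLT {u w : List X} {g : FreeAlgebra k X} (h : RRew x p pOp u g)
    (hu : List.Shortlex (· < ·) u w) : wordMon k u - g ∈ rewriteLT x p pOp w :=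
  Submodule.subset_span ⟨u, g, h, hu, by simp⟩

lemma RRew.sub_mem_rewriteLE {u : List X} {g : FreeAlgebra k X} (h : RRew x p pOp u g)
    {d : ℕ} (hu : u.length ≤ d) : wordMon k u - g ∈ rewriteLE x p pOp d :=
  Submodule.subset_span ⟨u, g, h, hu, rfl⟩

lemma rewriteLE_mono {d d' : ℕ} (h : d ≤ d') : rewriteLE x p pOp d ≤ rewriteLE x p pOp d' := by
  refine Submodule.span_mono ?_
  rintro _ ⟨u, g, hg, hu, rfl⟩
  exact ⟨u, g, hg, hu.trans h, rfl⟩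

lemma rewriteLE_le_rewriteLT {d : ℕ} {w : List X} (h : d < w.length) :
    rewriteLE x p pOp d ≤ rewriteLT x p pOp w := by
  refine Submodule.span_le.2 ?_
  rintro _ ⟨u, g, hg, hu, rfl⟩
  exact hg.sub_mem_rewriteLT (.of_length_lt (hu.trans_lt h))

lemma mul_mul_mem_rewriteLT {w : List X} {z : FreeAlgebra k X} (hz : z ∈ rewriteLT x p pOp w)
    (a c : List X) :
    wordMon k a * z * wordMon k c ∈ rewriteLT x p pOp (a ++ w ++ c) := by
  let T : FreeAlgebra k X →ₗ[k] FreeAlgebra k X :=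
    LinearMap.mulLeft k (wordMon k a) ∘ₗ LinearMap.mulRight k (wordMon k c)
  have : rewriteLT x p pOp w ≤ (rewriteLT x p pOp (a ++ w ++ c)).comap T := by
    refine Submodule.span_le.2 ?_
    rintro _ ⟨u, g, hg, hu, rfl⟩
    have := (hg.append_append a c).sub_mem_rewriteLT (hu.append_append a c)
    simpa [T, mul_sub, sub_mul, mul_assoc] using this
  simpa [T, mul_assoc] using this hz

lemma mul_mul_mem_rewriteLE {d : ℕ} {z : FreeAlgebra k X} (hz : z ∈ rewriteLE x p pOp d)
    (a c : List X) :
    wordMon k a * z * wordMon k c ∈ rewriteLE x p pOp (a.length + d + c.length) := by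
  let T : FreeAlgebra k X →ₗ[k] FreeAlgebra k X :=
    LinearMap.mulLeft k (wordMon k a) ∘ₗ LinearMap.mulRight k (wordMon k c)
  have : rewriteLE x p pOp d ≤ (rewriteLE x p pOp (a.length + d + c.length)).comap T := by
    refine Submodule.span_le.2 ?_
    rintro _ ⟨u, g, hg, hu, rfl⟩
    have := (hg.append_append a c).sub_mem_rewriteLE (d := a.length + d + c.length)
      (by simp; omega)
    simpa [T, mul_sub, sub_mul, mul_assoc] using this
  simpa [T, mul_assoc] using this hz

lemma ι_mul_sub_mul_ι_mem_rewriteLE {d : ℕ} {z : FreeAlgebra k X}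
    (hz : z ∈ rewriteLE x p pOp d) (i : X) :
    FreeAlgebra.ι k i * z - z * FreeAlgebra.ι k i ∈ rewriteLE x p pOp (d + 1) := by
  have h1 := mul_mul_mem_rewriteLE hz [i] []
  have h2 := mul_mul_mem_rewriteLE hz [] [i]
  simp only [List.length_cons, List.length_nil, zero_add, add_zero, add_comm 1 d, wordMon_cons,
    wordMon_nil, mul_one, one_mul] at h1 h2
  exact sub_mem h1 h2

/-- Commutators of degree one elements reduce to Lie brackets. -/
lemma commutator_sub_mem_rewriteLE (y z : L) :
    basisLin x y * basisLin x z - basisLin x z * basisLin x y - basisLin x ⁅y, z⁆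
      ∈ rewriteLE x p pOp 2 := by
  have hlt : ∀ i j : X, i < j → FreeAlgebra.ι k j * FreeAlgebra.ι k i
      - FreeAlgebra.ι k i * FreeAlgebra.ι k j - basisLin x ⁅x j, x i⁆
      ∈ rewriteLE x p pOp 2 := by
    intro i j h
    have := (RRule.comm (x := x) (p := p) (pOp := pOp) i j h).rew [] []
    simpa [sub_sub] using this.sub_mem_rewriteLE (d := 2) (by simp)
  have hb : ∀ i j : X, FreeAlgebra.ι k j * FreeAlgebra.ι k i
      - FreeAlgebra.ι k i * FreeAlgebra.ι k j - basisLin x ⁅x j, x i⁆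
      ∈ rewriteLE x p pOp 2 := by
    intro i j
    rcases lt_trichotomy i j with h | rfl | h
    · exact hlt i j h
    · simp
    · have := neg_mem (hlt j i h)
      rw [← lie_skew, map_neg]
      convert this using 1
      abel
  have hy : y ∈ Submodule.span k (Set.range x) := by simp [x.span_eq]
  have hz : z ∈ Submodule.span k (Set.range x) := by simp [x.span_eq]
  induction hy using Submodule.span_induction with
  | zero => simp
  | add y y' _ _ h h' =>
    convert add_mem h h' using 1
    simp only [map_add, add_lie, add_mul, mul_add]; abel
  | smul c y _ h =>
    convert Submodule.smul_mem _ c h using 1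
    simp only [map_smul, smul_lie, smul_mul_assoc, mul_smul_comm, smul_sub]
  | mem y hy =>
    obtain ⟨j, rfl⟩ := hy
    induction hz using Submodule.span_induction with
    | zero => simp
    | add y y' _ _ h h' =>
      convert add_mem h h' using 1
      simp only [map_add, lie_add, add_mul, mul_add]; abel
    | smul c y _ h =>
      convert Submodule.smul_mem _ c h using 1
      simp only [map_smul, lie_smul, smul_mul_assoc, mul_smul_comm, smul_sub]
    | mem z hz =>
      obtain ⟨i, rfl⟩ := hz
      simpa using hb i j

lemma RRule.mem_span {s : List X} {f : FreeAlgebra k X} (hp : 2 ≤ p) (h : RRule x p pOp s f) :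
    f ∈ Submodule.span k (wordBasis k X '' {u | List.Shortlex (· < ·) u s}) := by
  have hlin : ∀ (s : List X) (y : L), 2 ≤ s.length →
      basisLin x y ∈ Submodule.span k (wordBasis k X '' {u | List.Shortlex (· < ·) u s}) := by
    intro s y hs
    have hy : y ∈ Submodule.span k (Set.range x) := by simp [x.span_eq]
    induction hy using Submodule.span_induction with
    | zero => simp
    | add y y' _ _ h h' => rw [map_add]; exact add_mem h h'
    | smul c y _ h => rw [map_smul]; exact Submodule.smul_mem _ c h
    | mem y hy =>
      obtain ⟨j, rfl⟩ := hy
      exact Submodule.subset_span ⟨[j], .of_length_lt (by simp; omega), by simp⟩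
  cases h with
  | comm i j h =>
    refine add_mem (Submodule.subset_span ⟨[i, j], ?_, by simp⟩) (hlin _ _ (by simp))
    exact .of_lex rfl (.rel h)
  | pow i => exact hlin _ _ (by simpa)

lemma RRew.mem_span {w : List X} {g : FreeAlgebra k X} (hp : 2 ≤ p) (h : RRew x p pOp w g) :
    g ∈ Submodule.span k (wordBasis k X '' {u | List.Shortlex (· < ·) u w}) := by
  obtain ⟨a, s, c, f, hs, rfl, rfl⟩ := h
  let T : FreeAlgebra k X →ₗ[k] FreeAlgebra k X :=
    LinearMap.mulLeft k (wordMon k a) ∘ₗ LinearMap.mulRight k (wordMon k c)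
  have : Submodule.span k (wordBasis k X '' {u | List.Shortlex (· < ·) u s}) ≤
      (Submodule.span k (wordBasis k X '' {u | List.Shortlex (· < ·) u (a ++ s ++ c)})).comap T := by
    refine Submodule.span_le.2 ?_
    rintro _ ⟨u, hu, rfl⟩
    refine Submodule.subset_span ⟨a ++ u ++ c, hu.append_append a c, ?_⟩
    simp [T]
  simpa [T, mul_assoc] using this (hs.mem_span hp)

end RestrictedRules

section PowerIdentity

variable {k A : Type*} [Field k] [Ring A] [Algebra k A]

lemma neg_one_pow_mul_choose_pred_eq_one (p : ℕ) [hp : Fact p.Prime] [CharP k p] (m r : ℕ)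
    (h : m + r + 1 = p) : (-1 : k) ^ r * ((m + r).choose r : ℕ) = 1 := by
  induction r generalizing m with
  | zero => simp
  | succ r ih =>
    have h1 := ih (m + 1) (by omega)
    have h2 : ((p.choose (r + 1) : ℕ) : k) = 0 :=
      (CharP.cast_eq_zero_iff k p _).2 (hp.out.dvd_choose_self (by omega) (by omega))
    obtain rfl := h
    rw [Nat.choose_succ_succ, Nat.cast_add] at h2
    rw [show m + 1 + r = m + (r + 1) by omega] at h1
    linear_combination h1 - (-1) ^ r * h2

/-- In characteristic `p`, the iterated commutator `(ad a)^(p-1)` is a sum of monomials. -/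
lemma sum_pow_mul_mul_pow_eq_iterate (p : ℕ) [hp : Fact p.Prime] [CharP k p] (q : ℕ)
    (hq : q + 1 = p) (a y : A) :
    ∑ l ∈ Finset.range (q + 1), a ^ l * y * a ^ (q - l) =
      ((LinearMap.mulLeft k a - LinearMap.mulRight k a) ^ q) y := by
  have hc : Commute (LinearMap.mulLeft k a) (-LinearMap.mulRight k a) :=
    Commute.neg_right (LinearMap.commute_mulLeft_right (R := k) a a)
  rw [sub_eq_add_neg, hc.add_pow, LinearMap.sum_apply]
  refine Finset.sum_congr rfl fun l hl => ?_
  have hl' : l ≤ q := by simpa [Nat.lt_succ_iff] using hl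
  obtain ⟨r, rfl⟩ := Nat.exists_eq_add_of_le hl'
  have h1 := neg_one_pow_mul_choose_pred_eq_one (k := k) p l r hq
  rw [Nat.choose_symm_add]
  have h2 : (-LinearMap.mulRight k a) ^ r = ((-1 : k) ^ r) • LinearMap.mulRight k (a ^ r) := by
    rw [← neg_one_smul k (LinearMap.mulRight k a), smul_pow, LinearMap.pow_mulRight]
  have h3 : (((l + r).choose r : ℕ) : Module.End k A) = ((((l + r).choose r : ℕ) : k)) • 1 := by
    rw [← Algebra.algebraMap_eq_smul_one, map_natCast]
  rw [Nat.add_sub_cancel_left, h2, h3, LinearMap.pow_mulLeft, mul_smul_comm, mul_smul_comm,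
    smul_mul_assoc, smul_smul, mul_one, mul_comm, h1]
  simp [mul_assoc]

end PowerIdentity

section Overlaps

variable {k L X : Type*} [Field k] [LieRing L] [LieAlgebra k L] [LinearOrder X]
  {x : Module.Basis X k L} {p : ℕ} {pOp : L → L}

lemma commutator_iterate_sub_mem_rewriteLE (i : X) (y : L) (m : ℕ) :
    ((LinearMap.mulLeft k (FreeAlgebra.ι k i) - LinearMap.mulRight k (FreeAlgebra.ι k i)) ^ m)
        (basisLin x y) - basisLin x ((LieAlgebra.ad k L (x i) ^ m) y)
      ∈ rewriteLE x p pOp (m + 1) := by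
  induction m with
  | zero => simp
  | succ m ih =>
    have h1 := ι_mul_sub_mul_ι_mem_rewriteLE ih i
    have h2 := rewriteLE_mono (show 2 ≤ m + 1 + 1 by omega)
      (commutator_sub_mem_rewriteLE (x := x) (p := p) (pOp := pOp) (x i)
        ((LieAlgebra.ad k L (x i) ^ m) y))
    convert add_mem h1 h2 using 1
    rw [pow_succ', pow_succ']
    simp only [Module.End.mul_apply, LieAlgebra.ad_apply, LinearMap.sub_apply,
      LinearMap.mulLeft_apply, LinearMap.mulRight_apply, basisLin_basis]
    noncomm_ring

lemma comm_comm_mem_rewriteLT {h i j : X} (hij : h < i) (hjk : i < j) :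
    (FreeAlgebra.ι k i * FreeAlgebra.ι k j + basisLin x ⁅x j, x i⁆) * FreeAlgebra.ι k h
      - FreeAlgebra.ι k j * (FreeAlgebra.ι k h * FreeAlgebra.ι k i + basisLin x ⁅x i, x h⁆)
      ∈ rewriteLT x p pOp [j, i, h] := by
  have hle : rewriteLE x p pOp 2 ≤ rewriteLT x p pOp [j, i, h] :=
    rewriteLE_le_rewriteLT (by simp)
  have r1 := ((RRule.comm (x := x) (p := p) (pOp := pOp) h j (hij.trans hjk)).rew
    [i] []).sub_mem_rewriteLT (w := [j, i, h]) (.of_lex rfl (.rel hjk))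
  have r2 := ((RRule.comm (x := x) (p := p) (pOp := pOp) h i hij).rew
    [] [j]).sub_mem_rewriteLT (w := [j, i, h]) (.of_lex rfl (.rel hjk))
  have r3 := ((RRule.comm (x := x) (p := p) (pOp := pOp) h j (hij.trans hjk)).rew
    [] [i]).sub_mem_rewriteLT (w := [j, i, h]) (.of_lex rfl (.cons (.rel hij)))
  have r4 := ((RRule.comm (x := x) (p := p) (pOp := pOp) i j hjk).rew
    [h] []).sub_mem_rewriteLT (w := [j, i, h]) (.of_lex rfl (.rel (hij.trans hjk)))
  have c1 := hle (commutator_sub_mem_rewriteLE (x := x) (p := p) (pOp := pOp) ⁅x j, x i⁆ (x h))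
  have c2 := hle (commutator_sub_mem_rewriteLE (x := x) (p := p) (pOp := pOp) ⁅x j, x h⁆ (x i))
  have c3 := hle (commutator_sub_mem_rewriteLE (x := x) (p := p) (pOp := pOp) ⁅x i, x h⁆ (x j))
  have jac : basisLin x ⁅⁅x j, x i⁆, x h⁆ - basisLin x ⁅⁅x j, x h⁆, x i⁆
      + basisLin x ⁅⁅x i, x h⁆, x j⁆ = 0 := by
    rw [← map_sub, ← map_add]
    convert map_zero (basisLin x)
    rw [lie_lie (x j) (x i) (x h), ← lie_skew ⁅x j, x h⁆ (x i), ← lie_skew ⁅x i, x h⁆ (x j)]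
    abel
  have := add_mem (sub_mem (sub_mem (add_mem r1 r2) r3) r4) (add_mem (sub_mem c1 c2) c3)
  convert this using 1
  rw [← sub_eq_zero]
  simp only [wordMon_append, wordMon_cons, wordMon_nil, basisLin_basis]
  rw [← jac]
  noncomm_ring

lemma commutator_pOp_sub_mem_rewriteLE [Fact p.Prime] [CharP k p]
    (hi : ∀ y z : L, ⁅pOp y, z⁆ = (LieAlgebra.ad k L y ^ p) z) (i j : X) {q : ℕ}
    (hq : q + 1 = p) :
    basisLin x (pOp (x i)) * FreeAlgebra.ι k j - FreeAlgebra.ι k j * basisLin x (pOp (x i))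
      - ∑ l ∈ Finset.range (q + 1), FreeAlgebra.ι k i ^ l * basisLin x ⁅x i, x j⁆ *
        FreeAlgebra.ι k i ^ (q - l) ∈ rewriteLE x p pOp p := by
  have hp2 : 2 ≤ p := (Fact.out : p.Prime).two_le
  rw [sum_pow_mul_mul_pow_eq_iterate (k := k) p q hq]
  have h1 := rewriteLE_mono hp2
    (commutator_sub_mem_rewriteLE (x := x) (p := p) (pOp := pOp) (pOp (x i)) (x j))
  have h2 := commutator_iterate_sub_mem_rewriteLE (x := x) (p := p) (pOp := pOp) i ⁅x i, x j⁆ q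
  rw [hi, ← hq, pow_succ, Module.End.mul_apply, LieAlgebra.ad_apply, hq] at h1
  rw [hq] at h2
  convert sub_mem h1 h2 using 1
  rw [basisLin_basis]
  abel

lemma comm_pow_mem_rewriteLT [Fact p.Prime] [CharP k p]
    (hi : ∀ y z : L, ⁅pOp y, z⁆ = (LieAlgebra.ad k L y ^ p) z) {i j : X} (hij : i < j)
    {q : ℕ} (hq : q + 1 = p) :
    (FreeAlgebra.ι k i * FreeAlgebra.ι k j + basisLin x ⁅x j, x i⁆) * FreeAlgebra.ι k i ^ q
      - FreeAlgebra.ι k j * basisLin x (pOp (x i))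
      ∈ rewriteLT x p pOp (j :: List.replicate p i) := by
  set I := FreeAlgebra.ι k i
  set J := FreeAlgebra.ι k j
  set f := basisLin x (pOp (x i))
  set Y := basisLin x ⁅x j, x i⁆ with hY
  have hY' : basisLin x ⁅x i, x j⁆ = - Y := by rw [hY, ← map_neg, lie_skew]
  have chain : ∀ m r, m + r = q →
      I * J * I ^ q - I ^ (m + 1) * J * I ^ r
        - ∑ l ∈ Finset.range m, I ^ (l + 1) * Y * I ^ (q - (l + 1))
        ∈ rewriteLT x p pOp (j :: List.replicate p i) := by
    intro m
    induction m with
    | zero => rintro r rfl; simp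
    | succ m ih =>
      intro r hr
      have h1 := ih (r + 1) (by omega)
      have h2 := ((RRule.comm (x := x) (p := p) (pOp := pOp) i j hij).rew
        (List.replicate (m + 1) i) (List.replicate r i)).sub_mem_rewriteLT
        (w := j :: List.replicate p i)
        (.of_lex (by simp; omega) (by rw [List.replicate_succ]; exact .rel hij))
      convert add_mem h1 h2 using 1
      rw [Finset.sum_range_succ, show q - (m + 1) = r by omega]
      simp only [wordMon_append, wordMon_cons, wordMon_nil, wordMon_replicate]
      rw [pow_succ' I r, pow_succ I (m + 1)]
      noncomm_ring
  have h1 := chain q 0 rfl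
  have h2 := ((RRule.pow (x := x) (p := p) (pOp := pOp) i).rew [] [j]).sub_mem_rewriteLT
    (w := j :: List.replicate p i)
    (.of_lex (by simp) (by rw [← hq, List.replicate_succ]; exact .rel hij))
  have h3 : _ ∈ rewriteLT x p pOp (j :: List.replicate p i) := rewriteLE_le_rewriteLT (by simp)
    (commutator_pOp_sub_mem_rewriteLE (x := x) hi i j hq)
  rw [hY', Finset.sum_range_succ'] at h3
  convert add_mem (add_mem h1 h2) h3 using 1
  simp only [wordMon_append, wordMon_cons, wordMon_nil, wordMon_replicate, mul_neg, neg_mul,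
    Finset.sum_neg_distrib, ← hq, pow_zero, mul_one, one_mul, Nat.sub_zero]
  simp only [add_mul]
  abel

lemma pow_comm_mem_rewriteLT [Fact p.Prime] [CharP k p]
    (hi : ∀ y z : L, ⁅pOp y, z⁆ = (LieAlgebra.ad k L y ^ p) z) {i j : X} (hij : j < i)
    {q : ℕ} (hq : q + 1 = p) :
    basisLin x (pOp (x i)) * FreeAlgebra.ι k j - FreeAlgebra.ι k i ^ q *
        (FreeAlgebra.ι k j * FreeAlgebra.ι k i + basisLin x ⁅x i, x j⁆)
      ∈ rewriteLT x p pOp (List.replicate p i ++ [j]) := by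
  set I := FreeAlgebra.ι k i
  set J := FreeAlgebra.ι k j
  set f := basisLin x (pOp (x i))
  set Y := basisLin x ⁅x i, x j⁆ with hY
  have chain : ∀ m, m ≤ q →
      I ^ m * J * I ^ (q - m + 1) - J * I ^ p
        - ∑ l ∈ Finset.range m, I ^ l * Y * I ^ (q - l)
        ∈ rewriteLT x p pOp (List.replicate p i ++ [j]) := by
    intro m
    induction m with
    | zero => intro _; simp [hq]
    | succ m ih =>
      intro hm
      have h1 := ih (by omega)
      obtain ⟨r, rfl⟩ := Nat.exists_eq_add_of_le hm
      have h2 := ((RRule.comm (x := x) (p := p) (pOp := pOp) j i hij).rew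
        (List.replicate m i) (List.replicate (r + 1) i)).sub_mem_rewriteLT
        (w := List.replicate p i ++ [j])
        (.of_lex (by simp; omega) (by
          have e : List.replicate p i = List.replicate m i ++ i :: i :: List.replicate r i := by
            rw [show p = m + (r + 1 + 1) by omega, List.replicate_add]; rfl
          rw [e]
          simp only [List.append_assoc]
          exact .append_left _ (.cons (.rel hij)) _))
      convert add_mem h1 h2 using 1
      rw [Finset.sum_range_succ, show m + 1 + r - (m + 1) = r by omega,
        show m + 1 + r - m = r + 1 by omega]
      simp only [wordMon_append, wordMon_cons, wordMon_nil, wordMon_replicate]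
      rw [pow_succ' I (r + 1), pow_succ I m]
      noncomm_ring
  have h1 := chain q le_rfl
  have h2 := ((RRule.pow (x := x) (p := p) (pOp := pOp) i).rew [j] []).sub_mem_rewriteLT
    (w := List.replicate p i ++ [j])
    (.of_lex (by simp) (by rw [← hq, List.replicate_succ]; exact .rel hij))
  have h3 : _ ∈ rewriteLT x p pOp (List.replicate p i ++ [j]) := rewriteLE_le_rewriteLT (by simp)
    (commutator_pOp_sub_mem_rewriteLE (x := x) hi i j hq)
  rw [Finset.sum_range_succ] at h3
  convert sub_mem (sub_mem h3 h1) h2 using 1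
  simp only [wordMon_append, wordMon_cons, wordMon_nil, wordMon_replicate,
    mul_one, Nat.sub_self, zero_add, pow_one, pow_zero, mul_add, ← mul_assoc]
  abel

lemma pow_pow_mem_rewriteLT [Fact p.Prime]
    (hi : ∀ y z : L, ⁅pOp y, z⁆ = (LieAlgebra.ad k L y ^ p) z) (i : X) (m : ℕ) :
    basisLin x (pOp (x i)) * FreeAlgebra.ι k i ^ m - FreeAlgebra.ι k i ^ m * basisLin x (pOp (x i))
      ∈ rewriteLT x p pOp (List.replicate p i ++ List.replicate m i) := by
  have hp2 : 2 ≤ p := (Fact.out : p.Prime).two_le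
  have h0 : ⁅pOp (x i), x i⁆ = 0 := by
    obtain ⟨q, rfl⟩ := Nat.exists_eq_add_of_le' (show 1 ≤ p by omega)
    rw [hi, pow_succ, Module.End.mul_apply, LieAlgebra.ad_apply, lie_self, map_zero]
  refine rewriteLE_le_rewriteLT (d := m + 1) (by simp; omega) ?_
  induction m with
  | zero => simp
  | succ m ih =>
    have h1 := mul_mul_mem_rewriteLE ih [] [i]
    have h2 := mul_mul_mem_rewriteLE
      (commutator_sub_mem_rewriteLE (x := x) (p := p) (pOp := pOp) (pOp (x i)) (x i))
      (List.replicate m i) []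
    rw [h0] at h2
    have h1' := rewriteLE_mono (show _ ≤ m + 1 + 1 by simp) h1
    have h2' := rewriteLE_mono (show _ ≤ m + 1 + 1 by simp) h2
    convert add_mem h1' h2' using 1
    simp only [wordMon_cons, wordMon_nil, wordMon_replicate, basisLin_basis, map_zero]
    rw [pow_succ]
    noncomm_ring

end Overlaps

section Confluence

variable {k L X : Type*} [Field k] [LieRing L] [LieAlgebra k L] [LinearOrder X]
  {x : Module.Basis X k L} {p : ℕ} {pOp : L → L}

/-- Rewriting two disjoint factors of a word. -/
lemma RRule.disjoint_mem_rewriteLT (hp : 2 ≤ p) {s s' : List X} {f f' : FreeAlgebra k X}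
    (h : RRule x p pOp s f) (h' : RRule x p pOp s' f') (d : List X) :
    f * wordMon k (d ++ s') - wordMon k (s ++ d) * f' ∈ rewriteLT x p pOp (s ++ d ++ s') := by
  have key1 : (wordMon k s - f) * wordMon k d * f' ∈ rewriteLT x p pOp (s ++ d ++ s') := by
    let T := LinearMap.mulLeft k ((wordMon k s - f) * wordMon k d)
    have : Submodule.span k (wordBasis k X '' {u | List.Shortlex (· < ·) u s'}) ≤
        (rewriteLT x p pOp (s ++ d ++ s')).comap T := by
      refine Submodule.span_le.2 ?_
      rintro _ ⟨u, hu, rfl⟩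
      have := (h.rew [] (d ++ u)).sub_mem_rewriteLT (w := s ++ d ++ s')
        (by simpa using hu.append_append (s ++ d) [])
      simpa [T, sub_mul, mul_assoc] using this
    simpa [T, mul_assoc] using this (h'.mem_span hp)
  have key2 : f * wordMon k d * (wordMon k s' - f') ∈ rewriteLT x p pOp (s ++ d ++ s') := by
    let T := LinearMap.mulRight k (wordMon k d * (wordMon k s' - f'))
    have : Submodule.span k (wordBasis k X '' {u | List.Shortlex (· < ·) u s}) ≤
        (rewriteLT x p pOp (s ++ d ++ s')).comap T := by
      refine Submodule.span_le.2 ?_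
      rintro _ ⟨u, hu, rfl⟩
      have := (h'.rew (u ++ d) []).sub_mem_rewriteLT (w := s ++ d ++ s')
        (by simpa using hu.append_append [] (d ++ s'))
      simpa [T, mul_sub, mul_assoc] using this
    simpa [T, mul_assoc] using this (h.mem_span hp)
  convert sub_mem key2 key1 using 1
  simp only [wordMon_append]
  noncomm_ring

/-- Two rewritings with properly overlapping left-hand sides. -/
lemma RRule.overlap_mem_rewriteLT [Fact p.Prime] [CharP k p] (hp : 2 < p)
    (hi : ∀ y z : L, ⁅pOp y, z⁆ = (LieAlgebra.ad k L y ^ p) z)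
    {s s' c d t : List X} {f f' : FreeAlgebra k X}
    (h : RRule x p pOp s f) (h' : RRule x p pOp s' f') (hs : s = c ++ d) (hs' : s' = d ++ t)
    (hd : d ≠ []) :
    f * wordMon k t - wordMon k c * f' ∈ rewriteLT x p pOp (s ++ t) := by
  obtain ⟨q, hq⟩ : ∃ q, q + 1 = p := ⟨p - 1, by omega⟩
  cases h with
  | comm i j hij =>
    have hcd : (c = [] ∧ d = [j, i]) ∨ (c = [j] ∧ d = [i]) := by
      rcases c with _ | ⟨a, _ | ⟨b, c⟩⟩ <;> simp_all
    cases h' with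
    | comm i' j' hij' =>
      rcases hcd with ⟨rfl, rfl⟩ | ⟨rfl, rfl⟩
      · simp only [List.cons_append, List.cons.injEq, List.nil_append] at hs'
        obtain ⟨rfl, rfl, rfl⟩ := hs'
        simp
      · simp only [List.cons_append, List.cons.injEq, List.nil_append] at hs'
        obtain ⟨rfl, rfl⟩ := hs'
        simpa using comm_comm_mem_rewriteLT hij' hij
    | pow i' =>
      have ht := (List.replicate_eq_append_iff.1 hs')
      rcases hcd with ⟨rfl, rfl⟩ | ⟨rfl, rfl⟩
      · have := ht.2.1
        simp only [List.length_cons, List.length_nil, zero_add, List.replicate_succ,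
          List.replicate_zero, List.cons.injEq, and_true] at this
        exact absurd (this.2.trans this.1.symm) hij.ne
      · obtain ⟨hl, h1, h2⟩ := ht
        simp only [List.length_cons, List.length_nil, zero_add, List.replicate_succ,
          List.replicate_zero, List.cons.injEq, and_true] at h1
        obtain rfl := h1
        have hlen : t.length = q := by simp at hl; omega
        rw [hlen] at h2
        obtain rfl := h2
        have := comm_pow_mem_rewriteLT (x := x) hi hij hq
        rw [← hq, List.replicate_succ] at this
        simpa [hq] using this
  | pow i =>
    obtain ⟨hl, h1, h2⟩ := List.replicate_eq_append_iff.1 hs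
    cases h' with
    | comm i' j' hij' =>
      have hdt : (d = [j'] ∧ t = [i']) ∨ (d = [j', i'] ∧ t = []) := by
        clear h1 h2 hl
        rcases d with _ | ⟨a, _ | ⟨b, d⟩⟩ <;> simp_all
      rcases hdt with ⟨rfl, rfl⟩ | ⟨rfl, rfl⟩
      · simp only [List.length_cons, List.length_nil, zero_add, List.replicate_succ,
          List.replicate_zero, List.cons.injEq, and_true] at h2
        obtain rfl := h2
        have hlen : c.length = q := by simp at hl; omega
        rw [hlen] at h1
        obtain rfl := h1
        simpa using pow_comm_mem_rewriteLT (x := x) hi hij' hq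
      · simp only [List.length_cons, List.length_nil, zero_add, List.replicate_succ,
          List.replicate_zero, List.cons.injEq, and_true] at h2
        exact absurd (h2.2.trans h2.1.symm) hij'.ne
    | pow i' =>
      obtain ⟨hl', h1', h2'⟩ := List.replicate_eq_append_iff.1 hs'
      have hii : i = i' := by
        rw [h2] at h1'
        rcases List.replicate_inj.1 h1' with ⟨_, h | h⟩
        · exact absurd (List.length_eq_zero_iff.1 h) hd
        · exact h
      subst hii
      have hlen : c.length = t.length := by omega
      rw [hlen] at h1
      rw [h1, h2', List.length_replicate]
      simpa using pow_pow_mem_rewriteLT (x := x) hi i t.length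

/-- A left-hand side of a rule is a factor of another one only if the rules coincide. -/
lemma RRule.inclusion (hp : 2 < p) {s s' c t : List X} {f f' : FreeAlgebra k X}
    (h : RRule x p pOp s f) (h' : RRule x p pOp s' f') (hs : s = c ++ s' ++ t) :
    c = [] ∧ t = [] ∧ f = f' := by
  cases h with
  | comm i j hij =>
    cases h' with
    | comm i' j' hij' =>
      have hl := congrArg List.length hs
      simp only [List.length_cons, List.length_nil, List.length_append] at hl
      obtain rfl : c = [] := List.length_eq_zero_iff.1 (by omega)
      obtain rfl : t = [] := List.length_eq_zero_iff.1 (by omega)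
      simp only [List.nil_append, List.append_nil, List.cons.injEq, and_true] at hs
      obtain ⟨rfl, rfl⟩ := hs
      simp
    | pow i' =>
      have hl := congrArg List.length hs
      simp at hl
      omega
  | pow i =>
    cases h' with
    | comm i' j' hij' =>
      have h1 : j' = i := List.eq_of_mem_replicate (n := p) (by rw [hs]; simp)
      have h2 : i' = i := List.eq_of_mem_replicate (n := p) (by rw [hs]; simp)
      exact absurd (h2.trans h1.symm) hij'.ne
    | pow i' =>
      have hl := congrArg List.length hs
      simp only [List.length_replicate, List.length_append] at hl
      obtain rfl : c = [] := List.length_eq_zero_iff.1 (by omega)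
      obtain rfl : t = [] := List.length_eq_zero_iff.1 (by omega)
      simp only [List.nil_append, List.append_nil] at hs
      obtain rfl : i = i' := ((List.replicate_inj.1 hs).2).resolve_left (by omega)
      simp

lemma RRule.confluence_of_append [Fact p.Prime] [CharP k p] (hp : 2 < p)
    (hi : ∀ y z : L, ⁅pOp y, z⁆ = (LieAlgebra.ad k L y ^ p) z)
    {s s' b c b' : List X} {f f' : FreeAlgebra k X}
    (h : RRule x p pOp s f) (h' : RRule x p pOp s' f') (hs : s ++ b = c ++ (s' ++ b')) :
    f * wordMon k b - wordMon k c * f' * wordMon k b' ∈ rewriteLT x p pOp (s ++ b) := by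
  rcases List.append_eq_append_iff.1 hs with ⟨d, rfl, rfl⟩ | ⟨d, hd, hd'⟩
  · have := mul_mul_mem_rewriteLT (h.disjoint_mem_rewriteLT (by omega) h' d) [] b'
    simpa [sub_mul, mul_assoc] using this
  · rcases List.append_eq_append_iff.1 hd' with ⟨t, rfl, rfl⟩ | ⟨t, ht, rfl⟩
    · obtain ⟨rfl, rfl, rfl⟩ := h.inclusion hp h' (c := c) (t := t) (by simpa using hd)
      simp
    · by_cases hdn : d = []
      · subst hdn
        simp only [List.append_nil, List.nil_append] at hd ht
        subst hd ht
        have := mul_mul_mem_rewriteLT (h.disjoint_mem_rewriteLT (by omega) h' []) [] b'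
        simpa [sub_mul, mul_assoc] using this
      · have := mul_mul_mem_rewriteLT (h.overlap_mem_rewriteLT hp hi h' hd ht hdn) [] b'
        simpa [sub_mul, mul_assoc] using this

/-- The reduction rules of the restricted enveloping algebra are confluent. -/
theorem RRew.confluence [Fact p.Prime] [CharP k p] (hp : 2 < p)
    (hi : ∀ y z : L, ⁅pOp y, z⁆ = (LieAlgebra.ad k L y ^ p) z)
    (w : List X) (g g' : FreeAlgebra k X) (h : RRew x p pOp w g) (h' : RRew x p pOp w g') :
    g - g' ∈ rewriteLT x p pOp w := by
  obtain ⟨a, s, b, f, hs, rfl, rfl⟩ := h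
  obtain ⟨a', s', b', f', hs', hw, rfl⟩ := h'
  rw [List.append_assoc, List.append_assoc] at hw
  rcases List.append_eq_append_iff.1 hw with ⟨c, rfl, hc⟩ | ⟨c, rfl, hc⟩
  · have := mul_mul_mem_rewriteLT (hs.confluence_of_append hp hi hs' hc) a []
    simpa [mul_sub, mul_assoc] using this
  · have := neg_mem (mul_mul_mem_rewriteLT (hs'.confluence_of_append hp hi hs hc) a' [])
    rw [hc] at this
    simpa [mul_sub, mul_assoc] using this

end Confluence

section InvariantIdeal

variable {k A V : Type*} [CommRing k] [Ring A] [Algebra k A] [AddCommGroup V] [Module k V]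

/-- The largest two-sided ideal contained in the kernel of a linear map. -/
def kerIdeal (N : A →ₗ[k] V) : Ideal A where
  carrier := {z | ∀ a c, N (a * z * c) = 0}
  add_mem' h h' a c := by rw [mul_add, add_mul, map_add, h, h', add_zero]
  zero_mem' a c := by simp
  smul_mem' y z h a c := by rw [smul_eq_mul, ← mul_assoc, h]

lemma mem_kerIdeal {N : A →ₗ[k] V} {z : A} : z ∈ kerIdeal N ↔ ∀ a c, N (a * z * c) = 0 := Iff.rfl

instance (N : A →ₗ[k] V) : (kerIdeal N).IsTwoSided where
  mul_mem_of_left y h a c := by rw [← mul_assoc, mul_assoc, h]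

lemma mem_kerIdeal_of_basis {N : A →ₗ[k] V} {W : Type*} (b : Module.Basis W k A) {z : A}
    (h : ∀ u w, N (b u * z * b w) = 0) : z ∈ kerIdeal N := by
  let B : A →ₗ[k] A →ₗ[k] V := ((LinearMap.mul k A) ∘ₗ LinearMap.mulRight k z).compr₂ N
  have hB : B = 0 := LinearMap.ext_basis b b fun u w => by simpa [B] using h u w
  intro a c
  simpa [B] using LinearMap.congr_fun₂ hB a c

lemma kerIdeal_le_ker {N : A →ₗ[k] V} {z : A} (h : z ∈ kerIdeal N) : N z = 0 := by
  simpa using h 1 1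

end InvariantIdeal

section Independence

variable {k L X : Type*} [Field k] [LieRing L] [LieAlgebra k L]

/-- The words that are sorted and in which each letter occurs fewer than `p` times. -/
def IsNormalWord [LinearOrder X] (p : ℕ) (w : List X) : Prop :=
  w.Pairwise (· ≤ ·) ∧ ∀ i, w.count i < p

/-- The product in the restricted enveloping algebra of a word in the basis elements. -/
def wordProd (x : X → L) (p : ℕ) (pOp : L → L) (w : List X) : RUEA k L p pOp :=
  (w.map fun i => rι k p pOp (x i)).prod

variable [LinearOrder X] {x : Module.Basis X k L} {p : ℕ} {pOp : L → L}

lemma IsNormalWord.not_rew {w : List X} (h : IsNormalWord p w) (g : FreeAlgebra k X) :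
    ¬ RRew x p pOp w g := by
  rintro ⟨a, s, c, f, hs, rfl, -⟩
  cases hs with
  | comm i j hij =>
    have h1 : [j, i].Pairwise (· ≤ ·) :=
      h.1.sublist ((List.sublist_append_right a _).trans (List.sublist_append_left _ c))
    simp at h1
    exact absurd h1 hij.not_ge
  | pow i =>
    have := h.2 i
    simp [List.count_append] at this
    omega

attribute [local instance] LieRing.ofAssociativeRing

/-- Linear independence part of the restricted Poincaré–Birkhoff–Witt theorem. -/
theorem linearIndependent_wordProd [WellFoundedLT X] [CharP k p] (hp : 2 < p)
    (hi : ∀ x y : L, ⁅pOp x, y⁆ = (LieAlgebra.ad k L x ^ p) y)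
    (hii : ∀ (c : k) (x : L), pOp (c • x) = c ^ p • pOp x)
    (hiii : ∀ x y : L,
      UniversalEnvelopingAlgebra.ι k (pOp (x + y)) - UniversalEnvelopingAlgebra.ι k (pOp x)
          - UniversalEnvelopingAlgebra.ι k (pOp y)
        = UniversalEnvelopingAlgebra.ι k (x + y) ^ p - UniversalEnvelopingAlgebra.ι k x ^ p
          - UniversalEnvelopingAlgebra.ι k y ^ p) :
    LinearIndependent k fun w : {w : List X // IsNormalWord p w} =>
      wordProd (k := k) x p pOp (w : List X) := by
  have hprime : Fact p.Prime :=
    ⟨(CharP.char_is_prime_or_zero k p).resolve_right (by omega)⟩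
  have hr : WellFounded (List.Shortlex (α := X) (· < ·)) := List.Shortlex.wf wellFounded_lt
  let N := normalForm (wordBasis k X) hr (RRew x p pOp)
  have hN : ∀ w g, RRew x p pOp w g → N (wordMon k w) = N g := by
    intro w g h
    rw [← wordBasis_apply]
    exact normalForm_eq_of_rewrite (wordBasis k X) hr (RRew x p pOp)
      (fun w g h => h.mem_span hp.le) (fun w g g' h h' => h.confluence hp hi w g g' h') w g h
  let I := kerIdeal N
  have hrule : ∀ w g, RRew x p pOp w g → wordMon k w - g ∈ I := by
    intro w g h
    refine mem_kerIdeal_of_basis (wordBasis k X) fun a c => ?_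
    have := hN _ _ (h.append_append a c)
    simp only [wordMon_append] at this
    simp [mul_sub, sub_mul, this]
  have hLE : ∀ d, ∀ z ∈ rewriteLE x p pOp d, z ∈ I := by
    intro d
    have : rewriteLE x p pOp d ≤ I.restrictScalars k := by
      refine Submodule.span_le.2 ?_
      rintro _ ⟨u, g, h, -, rfl⟩
      exact hrule u g h
    exact this
  let π : FreeAlgebra k X →ₐ[k] FreeAlgebra k X ⧸ I := Ideal.Quotient.mkₐ k I
  have hπ : ∀ z ∈ I, π z = 0 := fun z hz => Ideal.Quotient.eq_zero_iff_mem.2 hz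
  let ψ : L →ₗ⁅k⁆ FreeAlgebra k X ⧸ I :=
    { toLinearMap := π.toLinearMap ∘ₗ basisLin x
      map_lie' := by
        intro y z
        have := hπ _ (hLE _ _ (commutator_sub_mem_rewriteLE (x := x) (p := p) (pOp := pOp) y z))
        rw [map_sub, map_sub, map_mul, map_mul, sub_eq_zero] at this
        simp [LieRing.of_associative_ring_bracket, this] }
  have hψ : ∀ y, ψ y = π (basisLin x y) := fun y => rfl
  have hpow : ∀ y, ψ y ^ p = ψ (pOp y) := by
    intro y
    have hy : y ∈ Submodule.span k (Set.range x) := by simp [x.span_eq]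
    induction hy using Submodule.span_induction with
    | zero =>
      have := hii 0 0
      rw [zero_smul, zero_pow (by omega), zero_smul] at this
      rw [this, map_zero, zero_pow (by omega)]
    | add y z _ _ h h' =>
      have := congrArg (UniversalEnvelopingAlgebra.lift k ψ) (hiii y z)
      simp only [map_sub, map_pow, UniversalEnvelopingAlgebra.lift_ι_apply, h, h'] at this
      simpa using this.symm
    | smul c y _ h => rw [hii, map_smul, map_smul, smul_pow, h]
    | mem y hy =>
      obtain ⟨i, rfl⟩ := hy
      have := hπ _ (hrule _ _ ((RRule.pow (x := x) (p := p) (pOp := pOp) i).rew [] []))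
      rw [map_sub, sub_eq_zero] at this
      simpa [hψ] using this
  let Ψ : RUEA k L p pOp →ₐ[k] FreeAlgebra k X ⧸ I :=
    RingQuot.liftAlgHom k ⟨UniversalEnvelopingAlgebra.lift k ψ, by
      rintro _ _ ⟨y, rfl, rfl⟩
      simp [hpow]⟩
  have hΨ : ∀ y, Ψ (rι k p pOp y) = ψ y := by
    intro y
    simp [Ψ, rι]
  let N' : (FreeAlgebra k X ⧸ I) →ₗ[k] FreeAlgebra k X :=
    (I.restrictScalars k).liftQ N fun z hz => kerIdeal_le_ker hz
  have hN' : ∀ z, N' (π z) = N z := fun z => rfl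
  refine LinearIndependent.of_comp (N' ∘ₗ Ψ.toLinearMap) ?_
  have : (N' ∘ₗ Ψ.toLinearMap) ∘ (fun w : {w : List X // IsNormalWord p w} =>
      wordProd (k := k) x p pOp (w : List X)) = fun w => wordBasis k X w.1 := by
    funext w
    have h1 : Ψ (wordProd x p pOp (w : List X)) = π (wordMon k (w : List X)) := by
      simp [wordProd, wordMon, map_list_prod, hΨ, hψ, Function.comp_def]
    simp only [Function.comp_apply, LinearMap.comp_apply, AlgHom.toLinearMap_apply, h1, hN']
    rw [← wordBasis_apply]
    exact normalForm_of_irreducible _ _ _ fun g => w.2.not_rew g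
  rw [this]
  exact (wordBasis k X).linearIndependent.comp _ Subtype.val_injective

end Independence

section Spanning

attribute [local instance] LieRing.ofAssociativeRing

variable {k L X : Type*} [Field k] [LieRing L] [LieAlgebra k L] [LinearOrder X]
  {x : Module.Basis X k L} {p : ℕ} {pOp : L → L}

omit [LinearOrder X] in
lemma rι_add (y z : L) : rι k p pOp (y + z) = rι k p pOp y + rι k p pOp z := by
  simp [rι]

omit [LinearOrder X] in
lemma rι_smul (c : k) (y : L) : rι k p pOp (c • y) = c • rι k p pOp y := by
  simp [rι]

omit [LinearOrder X] in
lemma rι_pow (y : L) : rι k p pOp y ^ p = rι k p pOp (pOp y) := by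
  rw [rι, rι, ← map_pow]
  exact RingQuot.mkAlgHom_rel k ⟨y, rfl, rfl⟩

omit [LinearOrder X] in
lemma rι_mul (y z : L) :
    rι k p pOp y * rι k p pOp z = rι k p pOp z * rι k p pOp y + rι k p pOp ⁅y, z⁆ := by
  simp [rι, LieHom.map_lie, LieRing.of_associative_ring_bracket]

variable (x p pOp) in
/-- The presentation of the restricted enveloping algebra by the words in a basis. -/
def presentation : FreeAlgebra k X →ₐ[k] RUEA k L p pOp :=
  FreeAlgebra.lift k fun i => rι k p pOp (x i)

omit [LinearOrder X] in
lemma presentation_wordMon (w : List X) :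
    presentation x p pOp (wordMon k w) = wordProd x p pOp w := by
  simp [presentation, wordMon, wordProd, map_list_prod, Function.comp_def]

omit [LinearOrder X] in
lemma presentation_basisLin (y : L) : presentation x p pOp (basisLin x y) = rι k p pOp y := by
  let f : L →ₗ[k] RUEA k L p pOp := ⟨⟨rι k p pOp, rι_add⟩, rι_smul⟩
  have : (presentation x p pOp).toLinearMap ∘ₗ basisLin x = f :=
    x.ext fun i => by simp [presentation, f]
  exact LinearMap.congr_fun this y

lemma RRew.presentation_eq {w : List X} {g : FreeAlgebra k X} (h : RRew x p pOp w g) :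
    presentation x p pOp (wordMon k w) = presentation x p pOp g := by
  obtain ⟨a, s, c, f, hs, rfl, rfl⟩ := h
  have : presentation x p pOp (wordMon k s) = presentation x p pOp f := by
    cases hs with
    | comm i j h =>
      simp only [wordMon_cons, wordMon_nil, mul_one, map_add, map_mul, presentation_basisLin]
      simpa [presentation] using rι_mul (x j) (x i)
    | pow i =>
      rw [wordMon_replicate, map_pow, presentation_basisLin, ← rι_pow]
      simp [presentation]
  simp [this, mul_assoc]

omit [LinearOrder X] in
lemma presentation_surjective : Function.Surjective (presentation x p pOp) := by
  let T := (presentation x p pOp).range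
  let ψ : L →ₗ⁅k⁆ T :=
    { toFun y := ⟨rι k p pOp y, basisLin x y, presentation_basisLin y⟩
      map_add' y z := Subtype.ext (rι_add y z)
      map_smul' c y := Subtype.ext (rι_smul c y)
      map_lie' {y z} := Subtype.ext <| by
        simp [LieRing.of_associative_ring_bracket, rι_mul y z] }
  let Ψ : RUEA k L p pOp →ₐ[k] T :=
    RingQuot.liftAlgHom k ⟨UniversalEnvelopingAlgebra.lift k ψ, by
      rintro _ _ ⟨y, rfl, rfl⟩
      simp only [map_pow, UniversalEnvelopingAlgebra.lift_ι_apply]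
      exact Subtype.ext (rι_pow y)⟩
  have hΨ : T.val.comp Ψ = AlgHom.id k _ := by
    refine RingQuot.ringQuot_ext' _ _ _ ?_
    refine UniversalEnvelopingAlgebra.hom_ext _ (LieHom.ext fun y => ?_)
    simp [Ψ, ψ, rι]
  intro u
  obtain ⟨z, hz⟩ := (Ψ u).2
  exact ⟨z, hz.trans (DFunLike.congr_fun hΨ u)⟩

lemma List.Pairwise.filter_append_filter {w : List X} (hw : w.Pairwise (· ≤ ·)) {P : X → Bool}
    (hP : ∀ i j, i ≤ j → P j → P i) : w.filter P ++ w.filter (fun i => !P i) = w := by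
  induction w with
  | nil => rfl
  | cons i w ih =>
    rw [List.pairwise_cons] at hw
    by_cases hi : P i
    · simp [hi, ih hw.2]
    · have h : ∀ j ∈ w, ¬ P j := fun j hj h => hi (hP i j (hw.1 j hj) h)
      rw [List.filter_eq_nil_iff.2 (by simpa [hi] using h),
        List.filter_eq_self.2 (by simpa [hi] using h), List.nil_append]

lemma exists_eq_append_of_not_isNormalWord {w : List X} (h : ¬ IsNormalWord p w) :
    (∃ a c i j, i < j ∧ w = a ++ [j, i] ++ c) ∨ ∃ a c i, w = a ++ List.replicate p i ++ c := by
  by_cases hw : w.Pairwise (· ≤ ·)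
  · right
    simp only [IsNormalWord, hw, true_and, not_forall, not_lt] at h
    obtain ⟨i, hi⟩ := h
    have h1 := hw.filter_append_filter (P := fun j => decide (j < i))
      (fun a b hab hb => by simp at hb ⊢; exact hab.trans_lt hb)
    have h2 := (hw.filter (fun j => !decide (j < i))).filter_append_filter
      (P := fun j => decide (j ≤ i)) (fun a b hab hb => by simp at hb ⊢; exact hab.trans hb)
    have h3 : (w.filter (fun j => !decide (j < i))).filter (fun j => decide (j ≤ i)) =
        List.replicate (w.count i) i := by
      rw [← List.filter_eq, List.filter_filter]
      refine List.filter_congr fun j _ => ?_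
      rw [Bool.eq_iff_iff]
      simpa using le_antisymm_iff.symm
    obtain ⟨m, hm⟩ := Nat.exists_eq_add_of_le hi
    rw [h3, hm, List.replicate_add] at h2
    rw [← h2] at h1
    exact ⟨_, _, i, by simpa only [List.append_assoc] using h1.symm⟩
  · left
    rw [← List.isChain_iff_pairwise, List.isChain_iff_forall_rel_of_append_cons_cons] at hw
    push Not at hw
    obtain ⟨j, i, a, c, h, hij⟩ := hw
    exact ⟨a, c, i, j, hij, by simp [h]⟩

/-- Spanning part of the restricted Poincaré–Birkhoff–Witt theorem. -/
theorem span_wordProd_eq_top [WellFoundedLT X] (hp : 2 ≤ p) :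
    Submodule.span k (Set.range fun w : {w : List X // IsNormalWord p w} =>
      wordProd (k := k) x p pOp w.1) = ⊤ := by
  have := eq_top_of_rewrite_of_irreducible (wordBasis k X)
    (List.Shortlex.wf (r := (· < ·)) wellFounded_lt) (RRew x p pOp) (fun w g h => h.mem_span hp)
    ((Submodule.span k (Set.range fun w : {w : List X // IsNormalWord p w} =>
      wordProd (k := k) x p pOp w.1)).comap (presentation x p pOp).toLinearMap)
    (fun w g h => by simp [h.presentation_eq])
    (fun w h => by
      refine Submodule.subset_span ⟨⟨w, ?_⟩, by simp [presentation_wordMon]⟩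
      by_contra hw
      rcases exists_eq_append_of_not_isNormalWord hw with ⟨a, c, i, j, hij, rfl⟩ | ⟨a, c, i, rfl⟩
      · exact h _ ((RRule.comm i j hij).rew a c)
      · exact h _ ((RRule.pow i).rew a c))
  rw [eq_top_iff]
  intro u _
  obtain ⟨z, rfl⟩ := presentation_surjective (x := x) (p := p) (pOp := pOp) u
  exact (this ▸ Submodule.mem_top : z ∈ _)

end Spanning

section NormalWords

variable {X Y : Type*} [LinearOrder X] [LinearOrder Y] {p : ℕ}

/-- The word in the ordered disjoint union obtained by concatenating a word in each summand. -/
def sumWord (u : List X) (v : List Y) : List (X ⊕ₗ Y) :=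
  u.map Sum.inlₗ ++ v.map Sum.inrₗ

omit [LinearOrder X] [LinearOrder Y] in
lemma sumWord_injective :
    Function.Injective fun q : List X × List Y => sumWord q.1 q.2 := by
  rintro ⟨u, v⟩ ⟨u', v'⟩ h
  have h1 := congrArg (List.filterMap fun i : X ⊕ₗ Y => (ofLex i).getLeft?) h
  have h2 := congrArg (List.filterMap fun i : X ⊕ₗ Y => (ofLex i).getRight?) h
  simp [sumWord, List.filterMap_map, Function.comp_def] at h1 h2
  simp [h1, h2]

omit [LinearOrder Y] in
lemma count_inlₗ_sumWord {_ : BEq (X ⊕ₗ Y)} [LawfulBEq (X ⊕ₗ Y)] (u : List X) (v : List Y) (i : X) :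
    (sumWord u v).count (Sum.inlₗ i) = u.count i := by
  have hi : Function.Injective (Sum.inlₗ : X → X ⊕ₗ Y) := toLex.injective.comp Sum.inl_injective
  rw [sumWord, List.count_append, List.count_map_of_injective _ _ hi,
    List.count_eq_zero_of_not_mem (l := v.map _) (by simp), add_zero]

omit [LinearOrder X] in
lemma count_inrₗ_sumWord {_ : BEq (X ⊕ₗ Y)} [LawfulBEq (X ⊕ₗ Y)] (u : List X) (v : List Y) (i : Y) :
    (sumWord u v).count (Sum.inrₗ i) = v.count i := by
  have hi : Function.Injective (Sum.inrₗ : Y → X ⊕ₗ Y) := toLex.injective.comp Sum.inr_injective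
  rw [sumWord, List.count_append, List.count_map_of_injective _ _ hi,
    List.count_eq_zero_of_not_mem (l := u.map _) (by simp), zero_add]

lemma isNormalWord_sumWord {u : List X} {v : List Y} :
    IsNormalWord p (sumWord u v) ↔ IsNormalWord p u ∧ IsNormalWord p v := by
  have h : (sumWord u v).Pairwise (· ≤ ·) ↔ u.Pairwise (· ≤ ·) ∧ v.Pairwise (· ≤ ·) := by
    simp [sumWord, List.pairwise_append, List.pairwise_map]
  rw [IsNormalWord, h]
  refine ⟨fun h' => ⟨⟨h'.1.1, fun i => ?_⟩, ⟨h'.1.2, fun i => ?_⟩⟩,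
    fun h' => ⟨⟨h'.1.1, h'.2.1⟩, fun i => ?_⟩⟩
  · have := h'.2 (Sum.inlₗ i)
    rwa [count_inlₗ_sumWord] at this
  · have := h'.2 (Sum.inrₗ i)
    rwa [count_inrₗ_sumWord] at this
  · obtain ⟨i | i, rfl⟩ := toLex.surjective i
    · exact lt_of_eq_of_lt (count_inlₗ_sumWord u v i) (h'.1.2 i)
    · exact lt_of_eq_of_lt (count_inrₗ_sumWord u v i) (h'.2.2 i)

lemma exists_sumWord_eq {w : List (X ⊕ₗ Y)} (hw : w.Pairwise (· ≤ ·)) :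
    ∃ u v, sumWord u v = w := by
  have h := hw.filter_append_filter (P := fun i => (ofLex i).isLeft) (fun i j hij hj => by
    obtain ⟨i | i, rfl⟩ := toLex.surjective i
    · simp
    · obtain ⟨j | j, rfl⟩ := toLex.surjective j
      · simp at hij
      · simp at hj)
  have hl : w.filter (fun i => (ofLex i).isLeft) ∈ Set.range (List.map Sum.inlₗ) := by
    rw [Set.range_list_map]
    intro i hi
    obtain ⟨i | i, rfl⟩ := toLex.surjective i
    · exact ⟨i, rfl⟩
    · simp at hi
  have hr : w.filter (fun i => !(ofLex i).isLeft) ∈ Set.range (List.map Sum.inrₗ) := by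
    rw [Set.range_list_map]
    intro i hi
    obtain ⟨i | i, rfl⟩ := toLex.surjective i
    · simp at hi
    · exact ⟨i, rfl⟩
  obtain ⟨u, hu⟩ := hl
  obtain ⟨v, hv⟩ := hr
  exact ⟨u, v, by rw [sumWord, hu, hv, h]⟩

/-- A normal word in an ordered disjoint union is a pair of normal words. -/
def normalWordSumEquiv : {u : List X // IsNormalWord p u} × {v : List Y // IsNormalWord p v} ≃
    {w : List (X ⊕ₗ Y) // IsNormalWord p w} :=
  Equiv.ofBijective (fun q => ⟨sumWord q.1.1 q.2.1, isNormalWord_sumWord.2 ⟨q.1.2, q.2.2⟩⟩) <| by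
    constructor
    · rintro ⟨⟨u, hu⟩, ⟨v, hv⟩⟩ ⟨⟨u', hu'⟩, ⟨v', hv'⟩⟩ h
      have := @sumWord_injective X Y (u, v) (u', v') (congrArg Subtype.val h)
      simpa using this
    · rintro ⟨w, hw⟩
      obtain ⟨u, v, rfl⟩ := exists_sumWord_eq hw.1
      have := isNormalWord_sumWord.1 hw
      exact ⟨⟨⟨u, this.1⟩, ⟨v, this.2⟩⟩, rfl⟩

/-- The sorted word with prescribed multiplicities. -/
def powWord {n : ℕ} (a : Fin n → ℕ) : List (Fin n) :=
  (List.finRange n).flatMap fun i => List.replicate (a i) i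

lemma count_powWord {n : ℕ} (a : Fin n → ℕ) (i : Fin n) : (powWord a).count i = a i := by
  rw [powWord, List.count_flatMap]
  simp [Function.comp_def, List.count_replicate, ← List.ofFn_eq_map, List.sum_ofFn]

lemma pairwise_powWord {n : ℕ} (a : Fin n → ℕ) : (powWord a).Pairwise (· ≤ ·) := by
  rw [powWord, List.pairwise_flatMap]
  refine ⟨fun i _ => by simp [List.pairwise_replicate], ?_⟩
  refine (List.pairwise_lt_finRange n).imp fun {i j} hij x hx y hy => ?_
  rw [List.eq_of_mem_replicate hx, List.eq_of_mem_replicate hy]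
  exact hij.le

/-- A normal word in `Fin n` is determined by its multiplicities. -/
def normalWordFinEquiv {n : ℕ} : (Fin n → Fin p) ≃ {w : List (Fin n) // IsNormalWord p w} where
  toFun a := ⟨powWord fun i => a i, pairwise_powWord _, fun i => by simp [count_powWord]⟩
  invFun w i := ⟨w.1.count i, w.2.2 i⟩
  left_inv a := by ext i; simp [count_powWord]
  right_inv w := by
    refine Subtype.ext (List.Perm.eq_of_pairwise' (pairwise_powWord _) w.2.1 ?_)
    simp [List.perm_iff_count, count_powWord]

end NormalWords

section Decomposition

lemma existsUnique_eq_sum {k R α β : Type*} [Field k] [AddCommGroup R] [Module k R] [Fintype α]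
    (T : α → R →ₗ[k] R) (V : β → R) (hli : LinearIndependent k fun q : α × β => T q.1 (V q.2))
    (hsp : Submodule.span k (Set.range fun q : α × β => T q.1 (V q.2)) = ⊤) (u : R) :
    ∃! c : α → R, (∀ a, c a ∈ Submodule.span k (Set.range V)) ∧ u = ∑ a, T a (c a) := by
  classical
  refine existsUnique_of_exists_of_unique ?_ ?_
  · have hu : u ∈ Submodule.span k (Set.range fun q : α × β => T q.1 (V q.2)) := by simp [hsp]
    induction hu using Submodule.span_induction with
    | zero => exact ⟨0, by simp⟩
    | add y z _ _ h h' =>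
      obtain ⟨c, hc, rfl⟩ := h
      obtain ⟨d, hd, rfl⟩ := h'
      exact ⟨c + d, fun a => add_mem (hc a) (hd a), by simp [Finset.sum_add_distrib]⟩
    | smul r y _ h =>
      obtain ⟨c, hc, rfl⟩ := h
      exact ⟨r • c, fun a => Submodule.smul_mem _ r (hc a), by simp [Finset.smul_sum]⟩
    | mem y hy =>
      obtain ⟨⟨a, b⟩, rfl⟩ := hy
      refine ⟨Pi.single a (V b), fun a' => ?_, ?_⟩
      · rcases eq_or_ne a' a with rfl | h
        · simpa using Submodule.subset_span (Set.mem_range_self b)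
        · simp [h]
      · rw [Finset.sum_eq_single a (fun a' _ h => by simp [h]) (by simp)]
        simp
  · rintro c d ⟨hc, hu⟩ ⟨hd, hu'⟩
    have hl : ∀ a, ∃ l : β →₀ k, Finsupp.linearCombination k V l = c a - d a := fun a =>
      Finsupp.mem_span_range_iff_exists_finsupp.1 (sub_mem (hc a) (hd a))
    choose l hl using hl
    have h0 : ∑ a, Finsupp.mapDomain (Prod.mk a) (l a) = 0 := by
      rw [linearIndependent_iff] at hli
      refine hli _ ?_
      have h : ∀ a, Finsupp.linearCombination k (fun q : α × β => T q.1 (V q.2))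
          (Finsupp.mapDomain (Prod.mk a) (l a)) = T a (c a) - T a (d a) := by
        intro a
        rw [Finsupp.linearCombination_mapDomain, ← map_sub, ← hl,
          Finsupp.apply_linearCombination]
        rfl
      rw [map_sum, Finset.sum_congr rfl fun a _ => h a, Finset.sum_sub_distrib, ← hu, ← hu',
        sub_self]
    funext a
    have hla : l a = 0 := by
      ext b
      have := DFunLike.congr_fun h0 (a, b)
      rw [Finsupp.finsetSum_apply, Finset.sum_eq_single a] at this
      · rwa [Finsupp.mapDomain_apply (Prod.mk_right_injective a)] at this
      · intro a' _ h
        exact Finsupp.mapDomain_of_notMem_range _ _ (by simp [h])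
      · simp
    rw [← sub_eq_zero, ← hl, hla, map_zero]

end Decomposition

section RelativeBasis

variable {k L X Y : Type*} [Field k] [LieRing L] [LieAlgebra k L] {p : ℕ} {pOp : L → L}

lemma wordProd_sumWord (x : X ⊕ₗ Y → L) (u : List X) (v : List Y) :
    wordProd (k := k) x p pOp (sumWord u v) =
      wordProd (x ∘ Sum.inlₗ) p pOp u * wordProd (x ∘ Sum.inrₗ) p pOp v := by
  simp [wordProd, sumWord, Function.comp_def]

lemma wordProd_powWord {n : ℕ} (e : Fin n → L) (a : Fin n → Fin p) :
    wordProd e p pOp (powWord fun i => a i) = eMonR k p pOp e a := by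
  rw [wordProd, powWord, eMonR]
  induction List.finRange n with
  | nil => rfl
  | cons i l ih => simp [ih]

/-- A basis of a subspace and representatives of a basis of the quotient form a basis. -/
def basisOfQuotient {V : Type*} [AddCommGroup V] [Module k V] {W : Submodule k V}
    (b : Module.Basis Y k W) (e : X → V)
    (hli : LinearIndependent k fun i => Submodule.Quotient.mk (p := W) (e i))
    (hsp : Submodule.span k (Set.range fun i => Submodule.Quotient.mk (p := W) (e i)) = ⊤) :
    Module.Basis (Y ⊕ X) k V :=
  Module.Basis.mk (v := Sum.elim (fun j => (b j : V)) e)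
    (LinearIndependent.sumElim_of_quotient b.linearIndependent e hli) (by
    have h : Submodule.span k (Set.range fun j => (b j : V)) = W := by
      rw [show (fun j => (b j : V)) = W.subtype ∘ b from rfl, Set.range_comp, ← Submodule.map_span,
        b.span_eq, Submodule.map_top, Submodule.range_subtype]
    rw [Set.Sum.elim_range, Submodule.span_union, h, top_le_iff, ← Submodule.map_mkQ_eq_top,
      Submodule.map_span, ← Set.range_comp]
    exact hsp)

instance [LinearOrder X] [LinearOrder Y] [WellFoundedLT X] [WellFoundedLT Y] :
    WellFoundedLT (X ⊕ₗ Y) :=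
  ⟨Sum.lex_wf wellFounded_lt wellFounded_lt⟩

lemma range_eq_span_wordProd [LinearOrder Y] [WellFoundedLT Y] {H : LieSubalgebra k L}
    {pOpH : H → H} {R : Type*} [Ring R] [Algebra k R] (φ : RUEA k H p pOpH →ₐ[k] R) (hp : 2 ≤ p)
    (b : Module.Basis Y k H) :
    Set.range φ = Submodule.span k
      (Set.range fun v : {v : List Y // IsNormalWord p v} => φ (wordProd b p pOpH v.1)) := by
  have h := congrArg (Submodule.map φ.toLinearMap)
    (span_wordProd_eq_top (x := b) (pOp := pOpH) hp)
  rw [Submodule.map_span, ← Set.range_comp, Submodule.map_top] at h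
  ext y
  exact (SetLike.ext_iff.1 h y).symm

end RelativeBasis

/-- Restricted PBW relative to a restricted subalgebra `𝔥 ⊆ 𝔤` with `𝔤/𝔥`
finite-dimensional of dimension `n`: fixing `e_1, …, e_n ∈ 𝔤` whose classes form a basis
of `𝔤/𝔥`, every element of `U'(𝔤)` is uniquely `Σ_a e^a · v_a` and uniquely
`Σ_a w_a · e^a` with the `v_a, w_a` in the image of `U'(𝔥) → U'(𝔤)`; in particular
`U'(𝔤)` is free as a left and as a right `U'(𝔥)`-module with basis `{e^a}`. -/
theorem statement8
    {k : Type*} [Field k] {L : Type*} [LieRing L] [LieAlgebra k L]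
    (p : ℕ) [CharP k p] (hp : 2 < p)
    (pOp : L → L)
    (hi : ∀ x y : L, ⁅pOp x, y⁆ = (LieAlgebra.ad k L x ^ p) y)
    (hii : ∀ (c : k) (x : L), pOp (c • x) = c ^ p • pOp x)
    (hiii : ∀ x y : L,
      UniversalEnvelopingAlgebra.ι k (pOp (x + y)) - UniversalEnvelopingAlgebra.ι k (pOp x)
          - UniversalEnvelopingAlgebra.ι k (pOp y)
        = UniversalEnvelopingAlgebra.ι k (x + y) ^ p - UniversalEnvelopingAlgebra.ι k x ^ p
          - UniversalEnvelopingAlgebra.ι k y ^ p)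
    (H : LieSubalgebra k L)
    (pOpH : H → H) (hpOpH : ∀ h : H, (pOpH h : L) = pOp (h : L))
    (φ : RUEA k H p pOpH →ₐ[k] RUEA k L p pOp)
    (hφ : ∀ h : H, φ (rι k p pOpH h) = rι k p pOp (h : L))
    (n : ℕ) (e : Fin n → L)
    (hli : LinearIndependent k
      (fun i => Submodule.Quotient.mk (p := H.toSubmodule) (e i)))
    (hsp : Submodule.span k
      (Set.range fun i => Submodule.Quotient.mk (p := H.toSubmodule) (e i)) = ⊤)
    (u : RUEA k L p pOp) :
    (∃! c : (Fin n → Fin p) → RUEA k L p pOp,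
      (∀ a, c a ∈ Set.range φ) ∧
        u = ∑ a : Fin n → Fin p, eMonR k p pOp e a * c a) ∧
    (∃! c : (Fin n → Fin p) → RUEA k L p pOp,
      (∀ a, c a ∈ Set.range φ) ∧
        u = ∑ a : Fin n → Fin p, c a * eMonR k p pOp e a) := by
  have hp' : 2 ≤ p := hp.le
  obtain ⟨_, _⟩ := exists_wellFoundedLT (α := Module.Basis.ofVectorSpaceIndex k H)
  let b := Module.Basis.ofVectorSpace k H
  let B := basisOfQuotient (W := H.toSubmodule) b e hli hsp
  let V : {v // IsNormalWord p v} → RUEA k L p pOp := fun v => φ (wordProd b p pOpH v.1)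
  have hV : ∀ v, V v = wordProd (fun j => (b j : L)) p pOp v.1 := by
    intro v
    simp [V, wordProd, map_list_prod, Function.comp_def, hφ]
  have hmem : ∀ y, y ∈ Set.range φ ↔ y ∈ Submodule.span k (Set.range V) := fun y => by
    rw [range_eq_span_wordProd φ hp' b]
    rfl
  simp only [hmem]
  constructor
  · let x := B.reindex ((Equiv.sumComm _ _).trans toLex)
    let E := (Equiv.prodCongr (normalWordFinEquiv (p := p) (n := n)) (Equiv.refl _)).trans
      (normalWordSumEquiv (Y := Module.Basis.ofVectorSpaceIndex k H))
    have hE : (fun q : (Fin n → Fin p) × {v // IsNormalWord p v} =>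
        LinearMap.mulLeft k (eMonR k p pOp e q.1) (V q.2)) =
        (fun w : {w // IsNormalWord p w} => wordProd (k := k) x p pOp w.1) ∘ E := by
      funext q
      have hx : x ∘ Sum.inlₗ = e := by ext; simp [x, B, basisOfQuotient]
      have hx' : x ∘ Sum.inrₗ = fun j => (b j : L) := by ext; simp [x, B, basisOfQuotient]
      change eMonR k p pOp e q.1 * V q.2 = wordProd x p pOp (sumWord (powWord _) q.2.1)
      rw [wordProd_sumWord, hx, hx', wordProd_powWord, hV]
    refine existsUnique_eq_sum (fun a => LinearMap.mulLeft k (eMonR k p pOp e a)) V ?_ ?_ u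
    · rw [hE]
      exact (linearIndependent_wordProd hp hi hii hiii).comp _ E.injective
    · rw [hE, E.surjective.range_comp]
      exact span_wordProd_eq_top hp'
  · let x := B.reindex toLex
    let E := ((Equiv.prodComm _ _).trans
      (Equiv.prodCongr (Equiv.refl _) (normalWordFinEquiv (p := p) (n := n)))).trans
      (normalWordSumEquiv (X := Module.Basis.ofVectorSpaceIndex k H))
    have hE : (fun q : (Fin n → Fin p) × {v // IsNormalWord p v} =>
        LinearMap.mulRight k (eMonR k p pOp e q.1) (V q.2)) =
        (fun w : {w // IsNormalWord p w} => wordProd (k := k) x p pOp w.1) ∘ E := by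
      funext q
      have hx : x ∘ Sum.inrₗ = e := by ext; simp [x, B, basisOfQuotient]
      have hx' : x ∘ Sum.inlₗ = fun j => (b j : L) := by ext; simp [x, B, basisOfQuotient]
      change V q.2 * eMonR k p pOp e q.1 = wordProd x p pOp (sumWord q.2.1 (powWord _))
      rw [wordProd_sumWord, hx, hx', wordProd_powWord, hV]
    refine existsUnique_eq_sum (fun a => LinearMap.mulRight k (eMonR k p pOp e a)) V ?_ ?_ u
    · rw [hE]
      exact (linearIndependent_wordProd hp hi hii hiii).comp _ E.injective
    · rw [hE, E.surjective.range_comp]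
      exact span_wordProd_eq_top hp'
end
end

section
/- The subspace A := Hom_{U'(𝔥)}(U'(𝔤), k) (k the trivial one-dimensional U'(𝔥)-module) is a subalgebra of the convolution algebra Hom_k(U'(𝔤), k); A is commutative; and A is a local ring whose unique maximal ideal is 𝔞 = {λ ∈ A : λ(1) = 0}. -/
open TensorProduct

noncomputable section

section

variable {k : Type*} [Field k] {L : Type*} [LieRing L] [LieAlgebra k L]
  (p : ℕ) (pOp : L → L) {H : LieSubalgebra k L} {pOpH : H → H}

/-- The convolution product on `Hom_k(U'(𝔤), k)`:
`(λ·μ)(u) = Σ λ(u₍₁₎)·μ(u₍₂₎)` where `Δ'(u) = Σ u₍₁₎ ⊗ u₍₂₎`. -/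
def rConv (Δ' : RUEA k L p pOp →ₐ[k] (RUEA k L p pOp ⊗[k] RUEA k L p pOp))
    (lam mu : RUEA k L p pOp →ₗ[k] k) : RUEA k L p pOp →ₗ[k] k :=
  (TensorProduct.lid k k).toLinearMap ∘ₗ TensorProduct.map lam mu ∘ₗ Δ'.toLinearMap

/-- `A = Hom_{U'(𝔥)}(U'(𝔤), k)`, for the trivial one-dimensional `U'(𝔥)`-module `k`
(on which `U'(𝔥)` acts through its counit `ε_𝔥`). -/
def trivCoindSet (φ : RUEA k H p pOpH →ₐ[k] RUEA k L p pOp)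
    (εH : RUEA k H p pOpH →ₐ[k] k) :
    Set (RUEA k L p pOp →ₗ[k] k) :=
  {lam | ∀ (w : RUEA k H p pOpH) (u : RUEA k L p pOp),
    lam (φ w * u) = εH w * lam u}

end

/-- The operator `u ↦ Σ λ(u₍₁₎) u₍₂₎` on an algebra with a comultiplication. -/
def slice {k U : Type*} [Field k] [Ring U] [Algebra k U]
    (Δ : U →ₐ[k] U ⊗[k] U) (lam : U →ₗ[k] k) : U →ₗ[k] U :=
  (TensorProduct.lid k U).toLinearMap ∘ₗ TensorProduct.map lam LinearMap.id ∘ₗ Δ.toLinearMap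

section Slice

variable {k U : Type*} [Field k] [Ring U] [Algebra k U] {Δ : U →ₐ[k] U ⊗[k] U}

theorem slice_one (lam : U →ₗ[k] k) : slice Δ lam 1 = lam 1 • (1 : U) := by
  simp [slice, Algebra.TensorProduct.one_def]

theorem slice_mul_of_primitive {x : U} (hx : Δ x = x ⊗ₜ 1 + 1 ⊗ₜ x) (lam : U →ₗ[k] k) (u : U) :
    slice Δ lam (x * u) = slice Δ (lam ∘ₗ LinearMap.mulLeft k x) u + x * slice Δ lam u := by
  simp only [slice, LinearMap.comp_apply, AlgHom.toLinearMap_apply, map_mul, hx]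
  induction Δ u using TensorProduct.induction_on with
  | zero => simp
  | tmul a b => simp [add_mul]
  | add a b ha hb => simp only [mul_add, map_add, ha, hb]; abel

theorem convolution_eq_comp_slice (lam mu : U →ₗ[k] k) :
    (TensorProduct.lid k k).toLinearMap ∘ₗ TensorProduct.map lam mu ∘ₗ Δ.toLinearMap =
      mu ∘ₗ slice Δ lam := by
  ext u
  simp only [slice, LinearMap.comp_apply]
  induction Δ.toLinearMap u using TensorProduct.induction_on with
  | zero => simp
  | tmul a b => simp
  | add a b ha hb => simp only [map_add, ha, hb]

/-- The filtration of `U` by degree in the elements of `s`, shifted by one. -/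
def degreeFiltration (k : Type*) {U : Type*} [Field k] [Ring U] [Algebra k U] (s : Set U) :
    ℕ → Submodule k U
  | 0 => ⊥
  | d + 1 => Submodule.span k (insert 1 s) ^ d

variable {s : Set U}

theorem degreeFiltration_le_succ (d : ℕ) :
    degreeFiltration k s d ≤ degreeFiltration k s (d + 1) := by
  cases d with
  | zero => exact bot_le
  | succ d =>
    change Submodule.span k (insert 1 s) ^ d ≤ Submodule.span k (insert 1 s) ^ (d + 1)
    rw [pow_succ]
    intro u hu
    simpa using Submodule.mul_mem_mul hu
      (Submodule.subset_span (Set.mem_insert (1 : U) s))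

theorem mul_mem_degreeFiltration {x u : U} (hx : x ∈ s) {d : ℕ}
    (hu : u ∈ degreeFiltration k s d) : x * u ∈ degreeFiltration k s (d + 1) := by
  cases d with
  | zero =>
    rw [(Submodule.mem_bot k).1 hu, mul_zero]
    exact zero_mem _
  | succ d =>
    change x * u ∈ Submodule.span k (insert 1 s) ^ (d + 1)
    rw [pow_succ']
    exact Submodule.mul_mem_mul (Submodule.subset_span (Set.mem_insert_of_mem 1 hx)) hu

theorem slice_sub_smul_mem (hΔ : ∀ x ∈ s, Δ x = x ⊗ₜ 1 + 1 ⊗ₜ x) (d : ℕ) :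
    ∀ u ∈ degreeFiltration k s (d + 1), ∀ lam : U →ₗ[k] k,
      slice Δ lam u - lam 1 • u ∈ degreeFiltration k s d := by
  induction d with
  | zero =>
    intro u hu lam
    obtain ⟨c, rfl⟩ := Submodule.mem_one.1 (show u ∈ (1 : Submodule k U) from by
      simpa [degreeFiltration] using hu)
    rw [Algebra.algebraMap_eq_smul_one, map_smul, slice_one, smul_comm, sub_self]
    exact zero_mem _
  | succ d ih =>
    intro u hu lam
    have hu' : u ∈ Submodule.span k (insert 1 s) * degreeFiltration k s (d + 1) := by
      change u ∈ _ * Submodule.span k (insert 1 s) ^ d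
      rw [← pow_succ']
      exact hu
    induction hu' using Submodule.mul_induction_on' with
    | mem_mul_mem v hv w hw =>
      have hslice : ∀ mu : U →ₗ[k] k, slice Δ mu w ∈ degreeFiltration k s (d + 1) := by
        intro mu
        rw [← sub_add_cancel (slice Δ mu w) (mu 1 • w)]
        exact add_mem (degreeFiltration_le_succ d (ih w hw mu)) (Submodule.smul_mem _ _ hw)
      clear hu
      induction hv using Submodule.span_induction with
      | mem x hx =>
        obtain rfl | hx := hx
        · rw [one_mul]
          exact degreeFiltration_le_succ d (ih w hw lam)
        · rw [slice_mul_of_primitive (hΔ x hx), add_sub_assoc, ← mul_smul_comm, ← mul_sub]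
          exact add_mem (hslice _) (mul_mem_degreeFiltration hx (ih w hw lam))
      | zero => simp
      | add a b _ _ ha hb =>
        rw [add_mul, map_add, smul_add, add_sub_add_comm]
        exact add_mem ha hb
      | smul c a _ ha =>
        rw [smul_mul_assoc, map_smul, smul_comm, ← smul_sub]
        exact Submodule.smul_mem _ _ ha
    | add a ha b hb iha ihb =>
      have hmem : ∀ v ∈ Submodule.span k (insert 1 s) * degreeFiltration k s (d + 1),
          v ∈ degreeFiltration k s (d + 2) := by
        intro v hv
        change v ∈ Submodule.span k (insert 1 s) ^ (d + 1)
        rw [pow_succ']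
        exact hv
      rw [map_add, smul_add, add_sub_add_comm]
      exact add_mem (iha (hmem a ha)) (ihb (hmem b hb))

theorem exists_mem_degreeFiltration (hs : Algebra.adjoin k s = ⊤) (u : U) :
    ∃ d, u ∈ degreeFiltration k s d := by
  suffices ∃ d, u ∈ Submodule.span k (insert 1 s) ^ d from
    let ⟨d, hd⟩ := this; ⟨d + 1, hd⟩
  have hmono : Monotone fun d => Submodule.span k (insert 1 s) ^ d :=
    monotone_nat_of_le_succ fun d => degreeFiltration_le_succ (d + 1)
  have hu : u ∈ Algebra.adjoin k s := hs ▸ Algebra.mem_top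
  induction hu using Algebra.adjoin_induction with
  | mem x hx => exact ⟨1, by simpa using Submodule.subset_span (Set.mem_insert_of_mem 1 hx)⟩
  | algebraMap c => exact ⟨0, by simp⟩
  | add a b _ _ ha hb =>
    obtain ⟨m, hm⟩ := ha
    obtain ⟨n, hn⟩ := hb
    exact ⟨max m n, add_mem (hmono (le_max_left m n) hm) (hmono (le_max_right m n) hn)⟩
  | mul a b _ _ ha hb =>
    obtain ⟨m, hm⟩ := ha
    obtain ⟨n, hn⟩ := hb
    exact ⟨m + n, by rw [pow_add]; exact Submodule.mul_mem_mul hm hn⟩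

theorem slice_bijective (hs : Algebra.adjoin k s = ⊤) (hΔ : ∀ x ∈ s, Δ x = x ⊗ₜ 1 + 1 ⊗ₜ x)
    {lam : U →ₗ[k] k} (hlam : lam 1 ≠ 0) : Function.Bijective (slice Δ lam) := by
  refine ⟨(injective_iff_map_eq_zero _).2 fun u hu => ?_, fun u => ?_⟩
  · obtain ⟨d, hd⟩ := exists_mem_degreeFiltration hs u
    induction d with
    | zero => exact hd
    | succ d ih =>
      have h := slice_sub_smul_mem hΔ d u hd lam
      rw [hu, zero_sub, neg_mem_iff] at h
      exact ih ((Submodule.smul_mem_iff _ hlam).1 h)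
  · obtain ⟨d, hd⟩ := exists_mem_degreeFiltration hs u
    induction d generalizing u with
    | zero => exact ⟨0, by rw [map_zero]; exact hd.symm⟩
    | succ d ih =>
      obtain ⟨v, hv⟩ := ih _ (slice_sub_smul_mem hΔ d u hd lam)
      refine ⟨(lam 1)⁻¹ • (u - v), ?_⟩
      rw [map_smul, map_sub, hv, sub_sub_cancel, inv_smul_smul₀ hlam]

end Slice

theorem UniversalEnvelopingAlgebra.adjoin_range_ι (k : Type*) [Field k] (L : Type*) [LieRing L]
    [LieAlgebra k L] :
    Algebra.adjoin k (Set.range (UniversalEnvelopingAlgebra.ι k : L → _)) = ⊤ := by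
  let S := Algebra.adjoin k (Set.range (UniversalEnvelopingAlgebra.ι k : L → _))
  let _ : LieRing S := LieRing.ofAssociativeRing
  let _ : LieRing (UniversalEnvelopingAlgebra k L) := LieRing.ofAssociativeRing
  let f : L →ₗ⁅k⁆ S :=
    { toFun x := ⟨UniversalEnvelopingAlgebra.ι k x, Algebra.subset_adjoin ⟨x, rfl⟩⟩
      map_add' x y := Subtype.ext (map_add _ x y)
      map_smul' c x := Subtype.ext (map_smul _ c x)
      map_lie' {x y} := Subtype.ext (LieHom.map_lie _ x y) }
  have hid : S.val.comp (UniversalEnvelopingAlgebra.lift k f) = AlgHom.id k _ := by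
    apply UniversalEnvelopingAlgebra.hom_ext
    ext x
    exact congrArg Subtype.val (UniversalEnvelopingAlgebra.lift_ι_apply k f x)
  refine eq_top_iff.2 fun u _ => ?_
  have hu : (UniversalEnvelopingAlgebra.lift k f u : UniversalEnvelopingAlgebra k L) = u :=
    DFunLike.congr_fun hid u
  rw [← hu]
  exact Subtype.prop _

theorem adjoin_range_rι {k : Type*} [Field k] {L : Type*} [LieRing L] [LieAlgebra k L]
    (p : ℕ) (pOp : L → L) : Algebra.adjoin k (Set.range (rι k p pOp)) = ⊤ := by
  have hrange : Set.range (rι k p pOp) = RingQuot.mkAlgHom k (rRel k L p pOp) ''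
      Set.range (UniversalEnvelopingAlgebra.ι k : L → _) := Set.range_comp _ _
  rw [hrange, ← AlgHom.map_adjoin, UniversalEnvelopingAlgebra.adjoin_range_ι, Algebra.map_top,
    AlgHom.range_eq_top]
  exact RingQuot.mkAlgHom_surjective k _

theorem mem_trivCoindSet_iff {k : Type*} [Field k] {L : Type*} [LieRing L] [LieAlgebra k L]
    {p : ℕ} {pOp : L → L} {H : LieSubalgebra k L} {pOpH : H → H}
    {φ : RUEA k H p pOpH →ₐ[k] RUEA k L p pOp} {εH : RUEA k H p pOpH →ₐ[k] k}
    (hφ : ∀ h : H, φ (rι k p pOpH h) = rι k p pOp (h : L))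
    (hεH : ∀ h : H, εH (rι k p pOpH h) = 0) {lam : RUEA k L p pOp →ₗ[k] k} :
    lam ∈ trivCoindSet p pOp φ εH ↔
      ∀ (h : H) (u : RUEA k L p pOp), lam (rι k p pOp (h : L) * u) = 0 := by
  refine ⟨fun hlam h u => by rw [← hφ, hlam, hεH, zero_mul], fun hlam w => ?_⟩
  have hw : w ∈ Algebra.adjoin k (Set.range (rι k p pOpH)) :=
    by
    rw [adjoin_range_rι]
    exact Algebra.mem_top
  induction hw using Algebra.adjoin_induction with
  | mem x hx =>
    obtain ⟨h, rfl⟩ := hx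
    intro u
    rw [hφ, hlam, hεH, zero_mul]
  | algebraMap c => intro u; simp [← Algebra.smul_def]
  | add a b _ _ ha hb => intro u; simp [add_mul, ha, hb]
  | mul a b _ _ ha hb => intro u; simp [mul_assoc, ha, hb]

/-- `A := Hom_{U'(𝔥)}(U'(𝔤), k)` is a subalgebra of the convolution algebra
`Hom_k(U'(𝔤), k)` (a subspace containing the unit `ε'` and closed under convolution),
it is commutative, and it is a local ring whose unique maximal ideal is
`𝔞 = {λ ∈ A : λ(1) = 0}`: an element of `A` is invertible in `A` iff it is not
in `𝔞`. -/
theorem statement16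
    {k : Type*} [Field k] {L : Type*} [LieRing L] [LieAlgebra k L]
    (p : ℕ) [CharP k p] (hp : 2 < p)
    (pOp : L → L)
    (hi : ∀ x y : L, ⁅pOp x, y⁆ = (LieAlgebra.ad k L x ^ p) y)
    (hii : ∀ (c : k) (x : L), pOp (c • x) = c ^ p • pOp x)
    (hiii : ∀ x y : L,
      UniversalEnvelopingAlgebra.ι k (pOp (x + y)) - UniversalEnvelopingAlgebra.ι k (pOp x)
          - UniversalEnvelopingAlgebra.ι k (pOp y)
        = UniversalEnvelopingAlgebra.ι k (x + y) ^ p - UniversalEnvelopingAlgebra.ι k x ^ p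
          - UniversalEnvelopingAlgebra.ι k y ^ p)
    (H : LieSubalgebra k L) [FiniteDimensional k (L ⧸ H.toSubmodule)]
    (pOpH : H → H) (hpOpH : ∀ h : H, (pOpH h : L) = pOp (h : L))
    (φ : RUEA k H p pOpH →ₐ[k] RUEA k L p pOp)
    (hφ : ∀ h : H, φ (rι k p pOpH h) = rι k p pOp (h : L))
    (Δ' : RUEA k L p pOp →ₐ[k] (RUEA k L p pOp ⊗[k] RUEA k L p pOp))
    (hΔ' : ∀ X : L, Δ' (rι k p pOp X)
      = rι k p pOp X ⊗ₜ[k] 1 + 1 ⊗ₜ[k] rι k p pOp X)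
    (ε' : RUEA k L p pOp →ₐ[k] k)
    (hε' : ∀ X : L, ε' (rι k p pOp X) = 0)
    (εH : RUEA k H p pOpH →ₐ[k] k)
    (hεH : ∀ h : H, εH (rι k p pOpH h) = 0) :
    (ε'.toLinearMap ∈ trivCoindSet p pOp φ εH) ∧
    (∀ lam ∈ trivCoindSet p pOp φ εH, ∀ mu ∈ trivCoindSet p pOp φ εH,
      lam + mu ∈ trivCoindSet p pOp φ εH) ∧
    (∀ (c : k), ∀ lam ∈ trivCoindSet p pOp φ εH,
      c • lam ∈ trivCoindSet p pOp φ εH) ∧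
    (∀ lam ∈ trivCoindSet p pOp φ εH, ∀ mu ∈ trivCoindSet p pOp φ εH,
      rConv p pOp Δ' lam mu ∈ trivCoindSet p pOp φ εH) ∧
    (∀ lam ∈ trivCoindSet p pOp φ εH, ∀ mu ∈ trivCoindSet p pOp φ εH,
      rConv p pOp Δ' lam mu = rConv p pOp Δ' mu lam) ∧
    (∀ lam ∈ trivCoindSet p pOp φ εH,
      ((∃ mu ∈ trivCoindSet p pOp φ εH,
        rConv p pOp Δ' lam mu = ε'.toLinearMap ∧
          rConv p pOp Δ' mu lam = ε'.toLinearMap) ↔ lam 1 ≠ 0)) := by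
  have hmem := @mem_trivCoindSet_iff k _ L _ _ p pOp H pOpH φ εH hφ hεH
  have hprim : ∀ x ∈ Set.range (rι k p pOp), Δ' x = x ⊗ₜ[k] 1 + 1 ⊗ₜ[k] x := by
    rintro _ ⟨X, rfl⟩
    exact hΔ' X
  have hslice : ∀ lam ∈ trivCoindSet p pOp φ εH, ∀ (h : H) (u : RUEA k L p pOp),
      slice Δ' lam (rι k p pOp (h : L) * u) = rι k p pOp (h : L) * slice Δ' lam u := by
    intro lam hlam h u
    have hzero : lam ∘ₗ LinearMap.mulLeft k (rι k p pOp (h : L)) = 0 :=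
      LinearMap.ext fun v => hmem.1 hlam h v
    rw [slice_mul_of_primitive (hΔ' h), hzero]
    simp [slice]
  have hcomm : ∀ lam mu : RUEA k L p pOp →ₗ[k] k,
      rConv p pOp Δ' lam mu = rConv p pOp Δ' mu lam := by
    intro lam mu
    have hcocomm : (Algebra.TensorProduct.comm k _ _).toAlgHom.comp Δ' = Δ' := by
      refine AlgHom.ext_of_adjoin_eq_top (adjoin_range_rι p pOp) ?_
      intro x hx
      simp [hprim x hx, add_comm]
    ext u
    have hu : Δ' u = TensorProduct.comm k _ _ (Δ' u) := (DFunLike.congr_fun hcocomm u).symm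
    change TensorProduct.lid k k (TensorProduct.map lam mu (Δ' u)) =
      TensorProduct.lid k k (TensorProduct.map mu lam (Δ' u))
    rw [hu]
    conv_rhs => rw [← hu]
    induction Δ' u using TensorProduct.induction_on with
    | zero => simp
    | tmul a b => simp [mul_comm]
    | add a b ha hb => simp only [map_add, ha, hb]
  have hconv : ∀ lam mu : RUEA k L p pOp →ₗ[k] k,
      rConv p pOp Δ' lam mu = mu ∘ₗ slice Δ' lam := convolution_eq_comp_slice
  refine ⟨hmem.2 fun h u => ?_, fun lam hlam mu hmu => hmem.2 fun h u => ?_,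
    fun c lam hlam => hmem.2 fun h u => ?_, fun lam hlam mu hmu => hmem.2 fun h u => ?_,
    fun lam _ mu _ => hcomm lam mu, fun lam hlam => ⟨?_, fun hone => ?_⟩⟩
  · simp [hε']
  · simp [hmem.1 hlam, hmem.1 hmu]
  · simp [hmem.1 hlam]
  · rw [hconv, LinearMap.comp_apply, hslice lam hlam, hmem.1 hmu]
  · rintro ⟨mu, -, hmul, -⟩ hzero
    have h := LinearMap.congr_fun hmul 1
    rw [hconv, LinearMap.comp_apply, slice_one, hzero] at h
    simp at h
  · let e := LinearEquiv.ofBijective (slice Δ' lam)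
      (slice_bijective (adjoin_range_rι p pOp) hprim hone)
    have hmul : rConv p pOp Δ' lam (ε'.toLinearMap ∘ₗ e.symm.toLinearMap) = ε'.toLinearMap := by
      rw [hconv]
      ext u
      exact congrArg ε' (e.symm_apply_apply u)
    refine ⟨ε'.toLinearMap ∘ₗ e.symm.toLinearMap, hmem.2 fun h u => ?_, hmul,
      (hcomm _ _).trans hmul⟩
    have he : e.symm (rι k p pOp (h : L) * u) = rι k p pOp (h : L) * e.symm u := by
      rw [LinearEquiv.symm_apply_eq]
      refine Eq.trans ?_ (hslice lam hlam h (e.symm u)).symm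
      exact congrArg _ (e.apply_symm_apply u).symm
    change ε' (e.symm (rι k p pOp (h : L) * u)) = 0
    rw [he, map_mul, hε', zero_mul]
end
end
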